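/- Let K be an algebraically closed field and A a finite dimensional hereditary K-algebra. If a torsion class 𝒯 in mod A is bicompact, then 𝒯 is functorially finite. -/

import Mathlib

namespace TorsPaper

variable (A : Type) [Ring A]

/-- `N` is (isomorphic to) a factor module of `M`. -/
def IsQuotientOf (N M : ModuleCat.{0} A) : Prop :=
  ∃ f : M →ₗ[A] N, Function.Surjective f

/-- `L` is (isomorphic to) a submodule of `M`. -/
def IsSubmoduleOf (L M : ModuleCat.{0} A) : Prop :=
  ∃ f : L →ₗ[A] M, Function.Injective f

/-- `M` is a nonzero module. -/
def Nonzero (M : ModuleCat.{0} A) : Prop := ∃ x : M, x ≠ 0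

/-- A torsion class in `mod A`: a class of finitely generated modules, containing the zero
modules, closed under isomorphisms (which follows from `quot`), factor modules and
extensions. -/
structure IsTorsionClass (T : ModuleCat.{0} A → Prop) : Prop where
  fin : ∀ M, T M → Module.Finite A M
  zero : ∀ M : ModuleCat.{0} A, (∀ x : M, x = 0) → T M
  quot : ∀ M N : ModuleCat.{0} A, T M → Module.Finite A N → IsQuotientOf A N M → T N
  ext : ∀ M : ModuleCat.{0} A, Module.Finite A M → ∀ N : Submodule A M,
    T (ModuleCat.of A N) → T (ModuleCat.of A (M ⧸ N)) → T M

/-- A torsion-free class in `mod A`. -/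
structure IsTorsionFreeClass (F : ModuleCat.{0} A → Prop) : Prop where
  fin : ∀ M, F M → Module.Finite A M
  zero : ∀ M : ModuleCat.{0} A, (∀ x : M, x = 0) → F M
  sub : ∀ M N : ModuleCat.{0} A, F M → Module.Finite A N → IsSubmoduleOf A N M → F N
  ext : ∀ M : ModuleCat.{0} A, Module.Finite A M → ∀ N : Submodule A M,
    F (ModuleCat.of A N) → F (ModuleCat.of A (M ⧸ N)) → F M

/-- The right Hom-perpendicular class `T^⊥` inside `mod A`. -/
def rightPerp (T : ModuleCat.{0} A → Prop) : ModuleCat.{0} A → Prop :=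
  fun X => Module.Finite A X ∧ ∀ M : ModuleCat.{0} A, T M → ∀ f : M →ₗ[A] X, f = 0

/-- The smallest torsion class containing a class `S` of modules. -/
def torsClosure (S : ModuleCat.{0} A → Prop) : ModuleCat.{0} A → Prop :=
  fun X => ∀ T : ModuleCat.{0} A → Prop, IsTorsionClass A T → (∀ Y, S Y → T Y) → T X

/-- The smallest torsion-free class containing a class `S` of modules. -/
def torfClosure (S : ModuleCat.{0} A → Prop) : ModuleCat.{0} A → Prop :=
  fun X => ∀ F : ModuleCat.{0} A → Prop, IsTorsionFreeClass A F → (∀ Y, S Y → F Y) → F X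

/-- A torsion class is compact if it is the smallest torsion class containing a single
module `M`. -/
def IsCompactTors (T : ModuleCat.{0} A → Prop) : Prop :=
  ∃ M : ModuleCat.{0} A, Module.Finite A M ∧ T = torsClosure A (fun X => X = M)

/-- A torsion class is cocompact if `T^⊥` is the smallest torsion-free class containing a
single module `N`. -/
def IsCocompactTors (T : ModuleCat.{0} A → Prop) : Prop :=
  ∃ N : ModuleCat.{0} A, Module.Finite A N ∧ rightPerp A T = torfClosure A (fun X => X = N)

/-- A torsion class is bicompact if it is both compact and cocompact. -/
def IsBicompactTors (T : ModuleCat.{0} A → Prop) : Prop :=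
  IsCompactTors A T ∧ IsCocompactTors A T

/-- A class `C` of modules is functorially finite in `mod A` if every finitely generated
module has a left `C`-approximation and a right `C`-approximation. -/
def FunctoriallyFinite (C : ModuleCat.{0} A → Prop) : Prop :=
  (∀ M : ModuleCat.{0} A, Module.Finite A M →
    ∃ (X : ModuleCat.{0} A) (f : M →ₗ[A] X), C X ∧
      ∀ Y : ModuleCat.{0} A, C Y → ∀ g : M →ₗ[A] Y, ∃ h : X →ₗ[A] Y, h.comp f = g) ∧
  (∀ M : ModuleCat.{0} A, Module.Finite A M →
    ∃ (X : ModuleCat.{0} A) (f : X →ₗ[A] M), C X ∧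
      ∀ Y : ModuleCat.{0} A, C Y → ∀ g : Y →ₗ[A] M, ∃ h : Y →ₗ[A] X, f.comp h = g)

/-- A stability function: a real-valued function on `mod A` which is additive on short
exact sequences. -/
def IsStability (θ : ModuleCat.{0} A → ℝ) : Prop :=
  ∀ L M N : ModuleCat.{0} A, Module.Finite A L → Module.Finite A M → Module.Finite A N →
    ∀ (f : L →ₗ[A] M) (g : M →ₗ[A] N), Function.Injective f → Function.Surjective g →
      LinearMap.range f = LinearMap.ker g → θ M = θ L + θ N

/-- The semistable torsion class `T_θ`. -/
def tTheta (θ : ModuleCat.{0} A → ℝ) : ModuleCat.{0} A → Prop :=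
  fun M => Module.Finite A M ∧ ∀ N : ModuleCat.{0} A, Module.Finite A N →
    IsQuotientOf A N M → Nonzero A N → 0 < θ N

/-- The semistable torsion class `\bar T_θ`. -/
def tThetaBar (θ : ModuleCat.{0} A → ℝ) : ModuleCat.{0} A → Prop :=
  fun M => Module.Finite A M ∧ ∀ N : ModuleCat.{0} A, Module.Finite A N →
    IsQuotientOf A N M → 0 ≤ θ N

/-- The semistable torsion-free class `F_θ`. -/
def fTheta (θ : ModuleCat.{0} A → ℝ) : ModuleCat.{0} A → Prop :=
  fun M => Module.Finite A M ∧ ∀ L : ModuleCat.{0} A, Module.Finite A L →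
    IsSubmoduleOf A L M → Nonzero A L → θ L < 0

/-- The semistable torsion-free class `\bar F_θ`. -/
def fThetaBar (θ : ModuleCat.{0} A → ℝ) : ModuleCat.{0} A → Prop :=
  fun M => Module.Finite A M ∧ ∀ L : ModuleCat.{0} A, Module.Finite A L →
    IsSubmoduleOf A L M → θ L ≤ 0

/-- An integer-valued function on `mod A` additive on short exact sequences; these are
exactly the group homomorphisms `K0(mod A) → ℤ`. -/
def IsAdditiveZ (φ : ModuleCat.{0} A → ℤ) : Prop :=
  ∀ L M N : ModuleCat.{0} A, Module.Finite A L → Module.Finite A M → Module.Finite A N →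
    ∀ (f : L →ₗ[A] M) (g : M →ₗ[A] N), Function.Injective f → Function.Surjective g →
      LinearMap.range f = LinearMap.ker g → φ M = φ L + φ N

/-- `[X] = [Y]` in the Grothendieck group `K0(mod A)`: since `K0(mod A)` is free abelian
on the simple modules, this holds iff all additive `ℤ`-valued functions agree on `X`, `Y`. -/
def SameK0Class (X Y : ModuleCat.{0} A) : Prop :=
  ∀ φ : ModuleCat.{0} A → ℤ, IsAdditiveZ A φ → φ X = φ Y

/-- Two classes of modules are numerically disjoint if they contain no nonzero `X`, `Y`
with `[X] = [Y] ≠ 0` in `K0(mod A)`. -/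
def NumericallyDisjoint (C D : ModuleCat.{0} A → Prop) : Prop :=
  ¬ ∃ X Y : ModuleCat.{0} A, C X ∧ D Y ∧ Nonzero A X ∧ Nonzero A Y ∧ SameK0Class A X Y

/-- A brick: a finitely generated module whose endomorphism algebra is a division algebra,
i.e. `M` is nonzero and every nonzero endomorphism is invertible. -/
def IsBrick (M : ModuleCat.{0} A) : Prop :=
  Module.Finite A M ∧ Nonzero A M ∧ ∀ f : M →ₗ[A] M, f ≠ 0 → Function.Bijective f

/-- A semibrick: a set of pairwise Hom-orthogonal bricks. -/
def IsSemibrick (S : Set (ModuleCat.{0} A)) : Prop :=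
  (∀ M ∈ S, IsBrick A M) ∧
    ∀ M ∈ S, ∀ N ∈ S, M ≠ N → ∀ f : M →ₗ[A] N, f = 0

end TorsPaper

namespace TorsAux
open Module Filter

section LinAlg
variable {K : Type} [Field K]

/-- Generic rank along a line. -/
lemma gen_rank {U V : Type} [AddCommGroup U] [Module K U] [AddCommGroup V] [Module K V]
    [FiniteDimensional K U] [FiniteDimensional K V] (a b : U →ₗ[K] V) (t0 : K) :
    ∀ᶠ t : K in cofinite, finrank K (LinearMap.range (a + t0 • b)) ≤
      finrank K (LinearMap.range (a + t • b)) := by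
  classical
  set c := a + t0 • b with hc
  set r := finrank K (LinearMap.range c) with hr
  obtain ⟨e⟩ : Nonempty (LinearMap.range c ≃ₗ[K] (Fin r → K)) :=
    FiniteDimensional.nonempty_linearEquiv_of_finrank_eq (by simp [hr])
  obtain ⟨s0, hs0⟩ := LinearMap.exists_rightInverse_of_surjective c.rangeRestrict
    (LinearMap.range_rangeRestrict c)
  obtain ⟨q0, hq0⟩ := LinearMap.exists_leftInverse_of_injective (LinearMap.range c).subtype
    (Submodule.ker_subtype _)
  set s : (Fin r → K) →ₗ[K] U := s0 ∘ₗ e.symm.toLinearMap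
  set q : V →ₗ[K] (Fin r → K) := e.toLinearMap ∘ₗ q0
  have hid : q ∘ₗ c ∘ₗ s = LinearMap.id := by
    ext1 i
    ext1
    simp only [q, s, LinearMap.comp_apply, LinearMap.id_apply, LinearEquiv.coe_coe]
    have h1 : c (s0 (e.symm (LinearMap.single K (fun _ => K) i 1))) =
        (LinearMap.range c).subtype (e.symm (LinearMap.single K (fun _ => K) i 1)) := by
      have := LinearMap.congr_fun hs0 (e.symm (LinearMap.single K (fun _ => K) i 1))
      simpa using congrArg Subtype.val this
    rw [h1]
    have h2 := LinearMap.congr_fun hq0 (e.symm (LinearMap.single K (fun _ => K) i 1))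
    simp only [LinearMap.comp_apply, LinearMap.id_apply] at h2
    rw [h2]; simp
  let α := LinearMap.toMatrix' (q ∘ₗ a ∘ₗ s)
  let β := LinearMap.toMatrix' (q ∘ₗ b ∘ₗ s)
  let p : Polynomial K := Matrix.det (α.map Polynomial.C + (Polynomial.X : Polynomial K) • β.map Polynomial.C)
  have hp : ∀ t, p.eval t = LinearMap.det (q ∘ₗ (a + t • b) ∘ₗ s) := by
    intro t
    rw [← LinearMap.det_toMatrix']
    have : (q ∘ₗ (a + t • b) ∘ₗ s) = q ∘ₗ a ∘ₗ s + t • (q ∘ₗ b ∘ₗ s) := by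
      ext; simp
    rw [this, map_add, map_smul]
    change Polynomial.eval t (Matrix.det _) = _
    rw [← Polynomial.coe_evalRingHom, RingHom.map_det]
    congr 1
    ext i j
    simp [α, β]
    exact mul_comm _ _
  have hp0 : p ≠ 0 := by
    intro h
    have := hp t0
    rw [h, ← hc, hid] at this
    simp at this
  have hfin : {t | p.IsRoot t}.Finite := Polynomial.finite_setOfPred_isRoot hp0
  have : ∀ᶠ t : K in cofinite, ¬ p.IsRoot t := by
    rw [Filter.eventually_cofinite]; simpa using hfin
  filter_upwards [this] with t ht
  rw [Polynomial.IsRoot, hp] at ht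
  have hu : IsUnit (LinearMap.det (q ∘ₗ (a + t • b) ∘ₗ s)) := isUnit_iff_ne_zero.mpr ht
  have hinj : Function.Injective (q ∘ₗ (a + t • b) ∘ₗ s) := by
    have h5 := (LinearMap.isUnit_iff_isUnit_det _).mpr hu
    exact ((Module.End.isUnit_iff _).mp h5).injective
  have hinj2 : Function.Injective ((a + t • b) ∘ₗ s) := by
    intro x y hxy
    exact hinj (by simp only [LinearMap.comp_apply] at hxy ⊢; rw [hxy])
  have h3 := LinearMap.finrank_range_of_inj hinj2
  rw [finrank_fin_fun] at h3
  rw [← h3]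
  exact Submodule.finrank_mono (LinearMap.range_comp_le_range _ _)

/-- If `h` has maximal rank among the `h + t e`, then `e` maps `ker h` into `im h`. -/
lemma tangent [Infinite K] {U V : Type} [AddCommGroup U] [Module K U] [AddCommGroup V] [Module K V]
    [FiniteDimensional K U] [FiniteDimensional K V] (h e : U →ₗ[K] V)
    (hmax : ∀ t : K, finrank K (LinearMap.range (h + t • e)) ≤ finrank K (LinearMap.range h))
    (u : U) (hu : h u = 0) : e u ∈ LinearMap.range h := by
  by_contra hne
  -- consider `U × K → V`, `(x, c) ↦ h x + c • e u`, deformed by `(x,c) ↦ e x`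
  let a : (U × K) →ₗ[K] V := h.coprod (LinearMap.toSpanSingleton K V (e u))
  let b : (U × K) →ₗ[K] V := e.coprod 0
  have h0 := gen_rank a b 0
  have h1 : ∀ᶠ t : K in cofinite, t ≠ 0 := by
    rw [Filter.eventually_cofinite]; simp
  obtain ⟨t, ht, ht0⟩ := (h0.and h1).exists
  have hle : LinearMap.range (a + t • b) ≤ LinearMap.range (h + t • e) := by
    rintro _ ⟨⟨x, c⟩, rfl⟩
    refine ⟨x + (c * t⁻¹) • u, ?_⟩
    simp [a, b, hu, smul_smul]
    rw [mul_comm c, ← mul_assoc, mul_inv_cancel₀ ht0, one_mul]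
    abel
  have hlt : LinearMap.range h < LinearMap.range (a + (0:K) • b) := by
    rw [zero_smul, add_zero]
    refine lt_of_le_of_ne ?_ ?_
    · rintro _ ⟨x, rfl⟩; exact ⟨(x, 0), by simp [a]⟩
    · intro heq
      apply hne
      rw [heq]
      exact ⟨(0, 1), by simp [a]⟩
  have := Submodule.finrank_lt_finrank_of_lt hlt
  have := Submodule.finrank_mono hle
  have := hmax t
  omega

end LinAlg
end TorsAux

namespace TorsAux
open Module Filter

section Blow
variable {K : Type} [Field K]
variable {V0 V1 E : Type} [AddCommGroup V0] [Module K V0] [AddCommGroup V1] [Module K V1]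
  [AddCommGroup E] [Module K E]

/-- The action of a matrix with entries in `E`. -/
def act (β : E →ₗ[K] V0 →ₗ[K] V1) {ι κ : Type} [Fintype ι] (c : ι → κ → E) :
    (ι → V0) →ₗ[K] (κ → V1) :=
  LinearMap.pi fun j => ∑ i, (β (c i j)) ∘ₗ LinearMap.proj i

lemma act_apply (β : E →ₗ[K] V0 →ₗ[K] V1) {ι κ : Type} [Fintype ι] (c : ι → κ → E)
    (φ : ι → V0) (j : κ) : act β c φ j = ∑ i, β (c i j) (φ i) := by
  simp [act]

lemma act_line (β : E →ₗ[K] V0 →ₗ[K] V1) {ι κ : Type} [Fintype ι] (c d : ι → κ → E) (t : K) :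
    act β (c + t • d) = act β c + t • act β d := by
  ext1 x
  ext φ
  simp [act_apply, Finset.sum_add_distrib, Finset.smul_sum]

/-- The image `E W`. -/
def EW (β : E →ₗ[K] V0 →ₗ[K] V1) (W : Submodule K V0) : Submodule K V1 :=
  ⨆ e, W.map (β e)

lemma EW_mono (β : E →ₗ[K] V0 →ₗ[K] V1) {W W' : Submodule K V0} (h : W ≤ W') :
    EW β W ≤ EW β W' := iSup_mono fun _ => Submodule.map_mono h

lemma mem_EW (β : E →ₗ[K] V0 →ₗ[K] V1) {W : Submodule K V0} (e : E) {w : V0} (hw : w ∈ W) :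
    β e w ∈ EW β W :=
  Submodule.mem_iSup_of_mem e (Submodule.mem_map_of_mem hw)

/-- corank -/
noncomputable def co {U V : Type} [AddCommGroup U] [Module K U] [AddCommGroup V] [Module K V]
    (f : U →ₗ[K] V) : ℝ := (finrank K V : ℝ) - finrank K (LinearMap.range f)

lemma co_nonneg {U V : Type} [AddCommGroup U] [Module K U] [AddCommGroup V] [Module K V]
    [FiniteDimensional K V] (f : U →ₗ[K] V) : 0 ≤ co f := by
  have := Submodule.finrank_le (LinearMap.range f)
  unfold co
  have : (finrank K (LinearMap.range f) : ℝ) ≤ finrank K V := by exact_mod_cast this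
  linarith

lemma co_eq {U V : Type} [AddCommGroup U] [Module K U] [AddCommGroup V] [Module K V]
    [FiniteDimensional K U] [FiniteDimensional K V] (f : U →ₗ[K] V) :
    co f = (finrank K V : ℝ) - finrank K U + finrank K (LinearMap.ker f) := by
  have := LinearMap.finrank_range_add_finrank_ker f
  unfold co
  have : (finrank K (LinearMap.range f) : ℝ) + finrank K (LinearMap.ker f) = finrank K U := by
    exact_mod_cast this
  linarith

lemma finrank_of_ker_le {U V : Type} [AddCommGroup U] [Module K U] [AddCommGroup V] [Module K V]
    [FiniteDimensional K U] (π : U →ₗ[K] V) (S : Submodule K U) (h : LinearMap.ker π ≤ S) :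
    finrank K S = finrank K (S.map π) + finrank K (LinearMap.ker π) := by
  have h1 := LinearMap.finrank_range_add_finrank_ker (π.domRestrict S)
  have h2 := (Submodule.submoduleOfEquivOfLe h).finrank_eq
  unfold Submodule.submoduleOf at h2
  rw [LinearMap.range_domRestrict, LinearMap.ker_domRestrict, h2] at h1
  exact h1.symm

/-- Functions on `κ × ι` all of whose slices lie in `S`. -/
def sl (κ : Type) {ι : Type} (S : Submodule K (ι → V0)) : Submodule K (κ × ι → V0) where
  carrier := {φ | ∀ b, (fun i => φ (b, i)) ∈ S}
  add_mem' := fun hx hy b => S.add_mem (hx b) (hy b)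
  zero_mem' := fun _ => S.zero_mem
  smul_mem' := fun c _ hx b => S.smul_mem c (hx b)

lemma finrank_sl (κ : Type) [Fintype κ] {ι : Type} [Fintype ι] [FiniteDimensional K V0]
    (S : Submodule K (ι → V0)) :
    finrank K (sl κ S) = Fintype.card κ * finrank K S := by
  let e : sl κ S ≃ₗ[K] (κ → S) :=
    { toFun := fun φ b => ⟨fun i => φ.1 (b, i), φ.2 b⟩
      invFun := fun ψ => ⟨fun x => (ψ x.1).1 x.2, fun b => (ψ b).2⟩
      left_inv := fun φ => rfl
      right_inv := fun ψ => rfl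
      map_add' := fun _ _ => rfl
      map_smul' := fun _ _ => rfl }
  rw [e.finrank_eq, finrank_pi_fintype]
  simp

/-- Block diagonal power. -/
def hpow (κ : Type) [DecidableEq κ] {ι : Type} (h : ι → ι → E) : κ × ι → κ × ι → E :=
  fun x y => if x.1 = y.1 then h x.2 y.2 else 0

lemma act_hpow (β : E →ₗ[K] V0 →ₗ[K] V1) (κ : Type) [Fintype κ] [DecidableEq κ] {ι : Type}
    [Fintype ι] (h : ι → ι → E) (φ : κ × ι → V0) (b : κ) (j : ι) :
    act β (hpow κ h) φ (b, j) = act β h (fun i => φ (b, i)) j := by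
  rw [act_apply, act_apply, Fintype.sum_prod_type, Finset.sum_eq_single b]
  · simp [hpow]
  · intro a _ hab
    simp [hpow, hab]
  · simp

lemma ker_hpow (β : E →ₗ[K] V0 →ₗ[K] V1) (κ : Type) [Fintype κ] [DecidableEq κ] {ι : Type}
    [Fintype ι] (h : ι → ι → E) :
    LinearMap.ker (act β (hpow κ h)) = sl κ (LinearMap.ker (act β h)) := by
  ext φ
  constructor
  · intro hφ b
    rw [LinearMap.mem_ker] at hφ ⊢
    ext j
    rw [← act_hpow, hφ]; rfl
  · intro hφ
    rw [LinearMap.mem_ker]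
    ext ⟨b, j⟩
    rw [act_hpow]
    have := hφ b
    rw [LinearMap.mem_ker] at this
    rw [this]; rfl

lemma co_hpow [FiniteDimensional K V0] [FiniteDimensional K V1] (β : E →ₗ[K] V0 →ₗ[K] V1)
    (κ : Type) [Fintype κ] [DecidableEq κ] {ι : Type}
    [Fintype ι] (h : ι → ι → E) :
    co (act β (hpow κ h)) = Fintype.card κ * co (act β h) := by
  rw [co_eq, co_eq, ker_hpow, finrank_sl, finrank_pi_fintype, finrank_pi_fintype,
    finrank_pi_fintype, finrank_pi_fintype]
  simp
  ring

lemma co_reindex [FiniteDimensional K V0] [FiniteDimensional K V1] (β : E →ₗ[K] V0 →ₗ[K] V1)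
    {κ ι : Type} [Fintype κ] [Fintype ι] (e : κ ≃ ι) (h : ι → ι → E) :
    co (act β (fun x y => h (e x) (e y))) = co (act β h) := by
  have key : ∀ φ : κ → V0, act β (fun x y => h (e x) (e y)) φ =
      fun y => act β h (fun i => φ (e.symm i)) (e y) := by
    intro φ
    ext y
    rw [act_apply, act_apply, ← Equiv.sum_comp e]
    simp
  have hk : finrank K (LinearMap.ker (act β (fun x y => h (e x) (e y)))) =
      finrank K (LinearMap.ker (act β h)) := by
    have : LinearMap.ker (act β (fun x y => h (e x) (e y))) =
        (LinearMap.ker (act β h)).comap (LinearEquiv.funCongrLeft K V0 e.symm).toLinearMap := by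
      ext φ
      simp only [LinearMap.mem_ker, Submodule.mem_comap]
      rw [key]
      constructor
      · intro hφ
        ext j
        have := congrFun hφ (e.symm j)
        simp only [Equiv.apply_symm_apply] at this
        exact this
      · intro hφ
        ext j
        exact congrFun hφ (e j)
    rw [this, Submodule.comap_equiv_eq_map_symm]
    exact LinearEquiv.finrank_map_eq _ _
  rw [co_eq, co_eq, hk, finrank_pi_fintype, finrank_pi_fintype, finrank_pi_fintype,
    finrank_pi_fintype]
  simp [Fintype.card_congr e]

/-- Generic element on a line, for two actions. -/
lemma co_line [Infinite K] {V0' V1' : Type} [AddCommGroup V0'] [Module K V0'] [AddCommGroup V1']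
    [Module K V1']
    [FiniteDimensional K V0] [FiniteDimensional K V1] [FiniteDimensional K V0']
    [FiniteDimensional K V1'] (β : E →ₗ[K] V0 →ₗ[K] V1) (β' : E →ₗ[K] V0' →ₗ[K] V1')
    {κ ι : Type} [Fintype κ] [Fintype ι] (h h' : ι → κ → E) :
    ∃ g : ι → κ → E, co (act β g) ≤ co (act β h) ∧ co (act β' g) ≤ co (act β' h') := by
  have h1 := gen_rank (act β h) (act β (h' - h)) 0
  have h2 := gen_rank (act β' h) (act β' (h' - h)) 1
  obtain ⟨t, ht1, ht2⟩ := (h1.and h2).exists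
  rw [← act_line, ← act_line] at ht1 ht2
  refine ⟨h + t • (h' - h), ?_, ?_⟩
  · unfold co
    rw [zero_smul, add_zero] at ht1
    have : (finrank K (LinearMap.range (act β h)) : ℝ) ≤ _ := Nat.cast_le.mpr ht1
    linarith
  · unfold co
    rw [one_smul, add_sub_cancel] at ht2
    have : (finrank K (LinearMap.range (act β' h')) : ℝ) ≤ _ := Nat.cast_le.mpr ht2
    linarith

/-- Pair lemma. -/
lemma pair_lemma [Infinite K] [FiniteDimensional K V0] [FiniteDimensional K V1]
    (β : E →ₗ[K] V0 →ₗ[K] V1) {κ ι : Type} [Fintype κ] [Fintype ι]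
    (h : ι → ι → E) (g : κ → κ → E) :
    ∃ (r : ℕ) (H : ι ⊕ κ → ι ⊕ κ → E) (U' : Submodule K (ι → V0)) (S : Submodule K (κ → V1)),
      co (act β H) ≤ co (act β h) + co (act β g) - r ∧
      U' ≤ LinearMap.ker (act β h) ∧
      finrank K (LinearMap.ker (act β h)) = finrank K U' + r ∧
      LinearMap.range (act β g) ≤ S ∧
      finrank K S = finrank K (LinearMap.range (act β g)) + r ∧
      ∀ (c : ι → κ → E), ∀ u ∈ U', act β c u ∈ S := by
  classical
  let Ψ : (ι → κ → E) → (LinearMap.ker (act β h) →ₗ[K] ((κ → V1) ⧸ LinearMap.range (act β g))) :=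
    fun c => (LinearMap.range (act β g)).mkQ ∘ₗ act β c ∘ₗ (LinearMap.ker (act β h)).subtype
  have hline : ∀ c d (t : K), Ψ (c + t • d) = Ψ c + t • Ψ d := by
    intro c d t
    ext1 x
    simp [Ψ, act_line]
  obtain ⟨c0, hc0⟩ : ∃ c0, ∀ c, finrank K (LinearMap.range (Ψ c)) ≤
      finrank K (LinearMap.range (Ψ c0)) := by
    have hb : BddAbove (Set.range fun c => finrank K (LinearMap.range (Ψ c))) := by
      refine ⟨finrank K ((κ → V1) ⧸ LinearMap.range (act β g)), ?_⟩
      rintro _ ⟨c, rfl⟩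
      exact Submodule.finrank_le _
    obtain ⟨c0, h0⟩ := Nat.sSup_mem (Set.range_nonempty
      (fun c => finrank K (LinearMap.range (Ψ c)))) hb
    refine ⟨c0, fun c => ?_⟩
    have := le_csSup hb ⟨c, rfl⟩
    simp only at h0
    rw [h0]; exact this
  let r := finrank K (LinearMap.range (Ψ c0))
  let U' := (LinearMap.ker (Ψ c0)).map (LinearMap.ker (act β h)).subtype
  let S := (LinearMap.range (Ψ c0)).comap (LinearMap.range (act β g)).mkQ
  have hU'fin : finrank K U' = finrank K (LinearMap.ker (Ψ c0)) :=
    (Submodule.equivMapOfInjective _ (Submodule.subtype_injective _) _).finrank_eq.symm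
  have hgS : LinearMap.range (act β g) ≤ S := by
    intro x hx
    simp only [S, Submodule.mem_comap]
    rw [Submodule.mkQ_apply, (Submodule.Quotient.mk_eq_zero _).mpr hx]
    exact Submodule.zero_mem _
  have hrn := LinearMap.finrank_range_add_finrank_ker (Ψ c0)
  let H : ι ⊕ κ → ι ⊕ κ → E := fun x y => Sum.elim (fun i => Sum.elim (fun i' => h i i') (fun k => c0 i k) y)
    (fun k => Sum.elim (fun _ => 0) (fun k' => g k k') y) x
  have hHl : ∀ φ i, act β H φ (Sum.inl i) = act β h (fun i => φ (Sum.inl i)) i := by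
    intro φ i
    rw [act_apply, act_apply, Fintype.sum_sum_type]
    simp [H]
  have hHr : ∀ φ k, act β H φ (Sum.inr k) = act β c0 (fun i => φ (Sum.inl i)) k +
      act β g (fun i => φ (Sum.inr i)) k := by
    intro φ k
    rw [act_apply, act_apply, act_apply, Fintype.sum_sum_type]
    simp [H]
  have hkerH : finrank K (LinearMap.ker (act β H)) ≤
      finrank K U' + finrank K (LinearMap.ker (act β g)) := by
    let p : LinearMap.ker (act β H) →ₗ[K] (ι → V0) :=
      LinearMap.funLeft K V0 Sum.inl ∘ₗ (LinearMap.ker (act β H)).subtype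
    have h1 := LinearMap.finrank_range_add_finrank_ker p
    have h2 : LinearMap.range p ≤ U' := by
      rintro _ ⟨⟨φ, hφ⟩, rfl⟩
      rw [LinearMap.mem_ker] at hφ
      have hφ1 : act β h (fun i => φ (Sum.inl i)) = 0 := by
        ext i; rw [← hHl, hφ]; rfl
      refine ⟨⟨fun i => φ (Sum.inl i), hφ1⟩, ?_, rfl⟩
      change Ψ c0 _ = 0
      simp only [Ψ, LinearMap.comp_apply, Submodule.subtype_apply, Submodule.mkQ_apply]
      rw [Submodule.Quotient.mk_eq_zero]
      refine ⟨-fun i => φ (Sum.inr i), ?_⟩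
      rw [map_neg, neg_eq_iff_add_eq_zero, add_comm]
      ext k
      rw [Pi.add_apply, ← hHr, hφ]; rfl
    let q : LinearMap.ker p →ₗ[K] LinearMap.ker (act β g) :=
      LinearMap.codRestrict _ (LinearMap.funLeft K V0 Sum.inr ∘ₗ
        (LinearMap.ker (act β H)).subtype ∘ₗ (LinearMap.ker p).subtype) (by
        rintro ⟨⟨φ, hφ⟩, hp⟩
        rw [LinearMap.mem_ker] at hφ hp ⊢
        have hφ1 : (fun i => φ (Sum.inl i)) = 0 := hp
        ext k
        have := hHr φ k
        rw [hφ, hφ1] at this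
        simp only [map_zero, Pi.zero_apply, zero_add] at this
        exact this.symm)
    have hq : Function.Injective q := by
      rintro ⟨⟨φ, hφ⟩, hp⟩ ⟨⟨ψ, hψ⟩, hp'⟩ hpq
      have hpq' : (fun i => φ (Sum.inr i)) = (fun i => ψ (Sum.inr i)) := congrArg Subtype.val hpq
      rw [LinearMap.mem_ker] at hp hp'
      have hφ1 : (fun i => φ (Sum.inl i)) = 0 := hp
      have hψ1 : (fun i => ψ (Sum.inl i)) = 0 := hp'
      have : φ = ψ := by
        ext x
        rcases x with x | x
        · exact (congrFun hφ1 x).trans (congrFun hψ1 x).symm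
        · exact congrFun hpq' x
      subst this
      rfl
    have h3 := LinearMap.finrank_le_finrank_of_injective hq
    have h4 := Submodule.finrank_mono h2
    omega
  refine ⟨r, H, U', S, ?_, ?_, ?_, ?_, ?_, ?_⟩
  · rw [co_eq, co_eq, co_eq, finrank_pi_fintype, finrank_pi_fintype, finrank_pi_fintype,
      finrank_pi_fintype, finrank_pi_fintype, finrank_pi_fintype]
    have h5 : (finrank K (LinearMap.ker (act β H)) : ℝ) ≤
      finrank K U' + finrank K (LinearMap.ker (act β g)) := by exact_mod_cast hkerH
    have h6 : (r : ℝ) + finrank K U' = finrank K (LinearMap.ker (act β h)) := by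
      rw [hU'fin]; exact_mod_cast hrn
    simp
    linarith
  · exact Submodule.map_subtype_le _ _
  · rw [hU'fin]; omega
  · exact hgS
  · have h1 := finrank_of_ker_le (LinearMap.range (act β g)).mkQ S (by
      rw [Submodule.ker_mkQ]; exact hgS)
    rw [Submodule.ker_mkQ, Submodule.map_comap_eq_of_surjective (Submodule.mkQ_surjective _)] at h1
    rw [h1, add_comm]
  · intro c u hu
    obtain ⟨⟨v, hv⟩, hv0, rfl⟩ := hu
    have := tangent (Ψ c0) (Ψ c) (fun t => by rw [← hline]; exact hc0 _) ⟨v, hv⟩ hv0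
    simpa [S, Ψ] using this

end Blow
end TorsAux

namespace TorsAux
open Module Filter

section Blow2
variable {K : Type} [Field K]

/-- Selection of an essential subspace. -/
lemma exists_core {V0 ι : Type} [AddCommGroup V0] [Module K V0] [FiniteDimensional K V0]
    [Fintype ι] (U : Submodule K (ι → V0)) (η : ℝ) (hη : 0 ≤ η) :
    ∃ Ws : Submodule K V0,
      (finrank K U : ℝ) ≤ finrank K (U ⊓ Submodule.pi Set.univ (fun _ => Ws) : Submodule K (ι → V0))
          + η * finrank K V0 ∧
      ∀ W : Submodule K V0, (finrank K U : ℝ) ≤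
        finrank K (U ⊓ Submodule.pi Set.univ (fun _ => W) : Submodule K (ι → V0)) + η → Ws ≤ W := by
  classical
  let good : Submodule K V0 → Prop := fun W => (finrank K U : ℝ) ≤
      finrank K (U ⊓ Submodule.pi Set.univ (fun _ => W) : Submodule K (ι → V0))
          + η * (finrank K V0 - finrank K W)
  have hex : ∃ n, ∃ W, good W ∧ finrank K W = n := by
    refine ⟨_, ⊤, ?_, rfl⟩
    have : (U ⊓ Submodule.pi Set.univ (fun _ => (⊤ : Submodule K V0)) : Submodule K (ι → V0)) = U := by
      simp
    simp only [good]
    rw [this]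
    simp
  obtain ⟨Ws, hWs, hn⟩ := Nat.find_spec hex
  refine ⟨Ws, ?_, ?_⟩
  · have h1 : 0 ≤ η * (finrank K Ws : ℝ) := by positivity
    have h2 : (finrank K U : ℝ) ≤
      finrank K (U ⊓ Submodule.pi Set.univ (fun _ => Ws) : Submodule K (ι → V0))
          + η * (finrank K V0 - finrank K Ws) := hWs
    linarith
  · intro W hW
    by_contra hle
    have hlt : Ws ⊓ W < Ws := lt_of_le_of_ne inf_le_left (fun h => hle (inf_eq_left.mp h))
    have hfl := Submodule.finrank_lt_finrank_of_lt hlt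
    refine Nat.find_min hex (m := finrank K (Ws ⊓ W : Submodule K V0)) (by omega)
      ⟨Ws ⊓ W, ?_, rfl⟩
    have h1 := Submodule.finrank_sup_add_finrank_inf_eq
      (U ⊓ Submodule.pi Set.univ (fun _ => Ws)) (U ⊓ Submodule.pi Set.univ (fun _ => W))
    have h2 : finrank K (U ⊓ Submodule.pi Set.univ (fun _ => Ws) ⊔
      U ⊓ Submodule.pi Set.univ (fun _ => W) : Submodule K (ι → V0)) ≤ finrank K U :=
      Submodule.finrank_mono (sup_le inf_le_left inf_le_left)
    have h3 : (U ⊓ Submodule.pi Set.univ (fun _ => Ws) ⊓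
      (U ⊓ Submodule.pi Set.univ (fun _ => W)) : Submodule K (ι → V0)) =
      U ⊓ Submodule.pi Set.univ (fun _ => Ws ⊓ W) := by
      ext x
      simp only [Submodule.mem_inf, Submodule.mem_pi, Set.mem_univ, true_imp_iff]
      constructor
      · rintro ⟨⟨a, b⟩, -, c⟩; exact ⟨a, fun i => ⟨b i, c i⟩⟩
      · rintro ⟨a, b⟩; exact ⟨⟨a, fun i => (b i).1⟩, a, fun i => (b i).2⟩
    rw [h3] at h1
    have h4 : (finrank K U : ℝ) ≤
      finrank K (U ⊓ Submodule.pi Set.univ (fun _ => Ws) : Submodule K (ι → V0))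
          + η * (finrank K V0 - finrank K Ws) := hWs
    change (finrank K U : ℝ) ≤ finrank K (U ⊓ Submodule.pi Set.univ (fun _ => Ws ⊓ W) :
      Submodule K (ι → V0)) + η * (finrank K V0 - finrank K (Ws ⊓ W : Submodule K V0))
    have h5 : (finrank K (Ws ⊓ W : Submodule K V0) : ℝ) + 1 ≤ finrank K Ws := by exact_mod_cast hfl
    have h6 : (finrank K (U ⊓ Submodule.pi Set.univ (fun _ => Ws) ⊔
      U ⊓ Submodule.pi Set.univ (fun _ => W) : Submodule K (ι → V0)) : ℝ) ≤ finrank K U := by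
      exact_mod_cast h2
    have h7 : (finrank K (U ⊓ Submodule.pi Set.univ (fun _ => Ws) ⊔
      U ⊓ Submodule.pi Set.univ (fun _ => W) : Submodule K (ι → V0)) : ℝ) +
      finrank K (U ⊓ Submodule.pi Set.univ (fun _ => Ws ⊓ W) : Submodule K (ι → V0)) =
      finrank K (U ⊓ Submodule.pi Set.univ (fun _ => Ws) : Submodule K (ι → V0)) +
      finrank K (U ⊓ Submodule.pi Set.univ (fun _ => W) : Submodule K (ι → V0)) := by
      exact_mod_cast h1
    nlinarith

/-- The induced action on the quotient by `W`. -/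
def qβ {V0 V1 E : Type} [AddCommGroup V0] [Module K V0] [AddCommGroup V1] [Module K V1]
    [AddCommGroup E] [Module K E] (β : E →ₗ[K] V0 →ₗ[K] V1) (W : Submodule K V0) :
    E →ₗ[K] (V0 ⧸ W) →ₗ[K] (V1 ⧸ EW β W) where
  toFun e := W.mapQ (EW β W) (β e) (fun _ hw => mem_EW β e hw)
  map_add' a b := by ext; simp
  map_smul' a b := by ext; simp

variable {V0 V1 E : Type} [AddCommGroup V0] [Module K V0] [AddCommGroup V1] [Module K V1]
  [AddCommGroup E] [Module K E]

lemma EW_qβ (β : E →ₗ[K] V0 →ₗ[K] V1) (W : Submodule K V0) (W' : Submodule K (V0 ⧸ W)) :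
    EW (qβ β W) W' = (EW β (W'.comap W.mkQ)).map (EW β W).mkQ := by
  unfold EW
  rw [Submodule.map_iSup]
  congr 1
  ext1 e
  ext x
  constructor
  · rintro ⟨y, hy, rfl⟩
    obtain ⟨z, rfl⟩ := W.mkQ_surjective y
    exact ⟨β e z, ⟨z, hy, rfl⟩, rfl⟩
  · rintro ⟨_, ⟨z, hz, rfl⟩, rfl⟩
    exact ⟨W.mkQ z, hz, rfl⟩

lemma act_qβ (β : E →ₗ[K] V0 →ₗ[K] V1) (W : Submodule K V0) {ι κ : Type} [Fintype ι]
    (h : ι → κ → E) (φ : ι → V0) (j : κ) :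
    act (qβ β W) h (fun i => W.mkQ (φ i)) j = (EW β W).mkQ (act β h φ j) := by
  rw [act_apply, act_apply, map_sum]
  rfl

lemma co_le_of_core [FiniteDimensional K V0] [FiniteDimensional K V1]
    (β : E →ₗ[K] V0 →ₗ[K] V1) (W : Submodule K V0) {ι : Type} [Fintype ι]
    (h : ι → ι → E) (S : Submodule K (ι → V1)) (hS : LinearMap.range (act β h) ≤ S)
    (hW : Submodule.pi Set.univ (fun _ => EW β W) ≤ S) :
    (finrank K (ι → V1) : ℝ) - finrank K S ≤ co (act (qβ β W) h) := by
  let π : (ι → V1) →ₗ[K] (ι → V1 ⧸ EW β W) := LinearMap.pi fun i => (EW β W).mkQ ∘ₗ LinearMap.proj i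
  have hπs : Function.Surjective π := by
    intro y
    choose z hz using fun i => (EW β W).mkQ_surjective (y i)
    exact ⟨z, by ext i; exact hz i⟩
  have hker : LinearMap.ker π ≤ S := by
    refine le_trans ?_ hW
    intro x hx i _
    rw [LinearMap.mem_ker] at hx
    have := congrFun hx i
    simpa [π] using this
  have h1 := finrank_of_ker_le π S hker
  have h2 := LinearMap.finrank_range_add_finrank_ker π
  rw [LinearMap.range_eq_top.mpr hπs, finrank_top] at h2
  have h3 : LinearMap.range (act (qβ β W) h) ≤ S.map π := by
    rintro _ ⟨φ, rfl⟩
    choose z hz using fun i => W.mkQ_surjective (φ i)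
    refine ⟨act β h z, hS ⟨z, rfl⟩, ?_⟩
    ext j
    have : φ = fun i => W.mkQ (z i) := by ext i; exact (hz i).symm
    rw [this, act_qβ]
    rfl
  have h4 := Submodule.finrank_mono h3
  unfold co
  have h1' : (finrank K S : ℝ) = finrank K (S.map π) + finrank K (LinearMap.ker π) := by
    exact_mod_cast h1
  have h2' : (finrank K (ι → V1 ⧸ EW β W) : ℝ) + finrank K (LinearMap.ker π) =
    finrank K (ι → V1) := by exact_mod_cast h2
  have h4' : (finrank K (LinearMap.range (act (qβ β W) h)) : ℝ) ≤ finrank K (S.map π) := by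
    exact_mod_cast h4
  linarith

end Blow2

/-- Asymptotic noncommutative rank theorem. -/
theorem blow {K : Type} [Field K] [Infinite K] {E : Type} [AddCommGroup E] [Module K E] (d : ℕ) :
    ∀ (V0 V1 : Type) [AddCommGroup V0] [Module K V0] [AddCommGroup V1] [Module K V1]
      [FiniteDimensional K V0] [FiniteDimensional K V1] (β : E →ₗ[K] V0 →ₗ[K] V1),
      finrank K V0 ≤ d →
      (∀ W : Submodule K V0, W ≠ ⊤ →
        finrank K V1 + finrank K W < finrank K V0 + finrank K (EW β W)) →
      EW β ⊤ = ⊤ → ∀ ε : ℝ, 0 < ε →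
      ∃ (ι : Type) (_ : Fintype ι) (_ : Nonempty ι) (h : ι → ι → E),
        co (act β h) ≤ ε * Fintype.card ι := by
  induction d with
  | zero =>
    intro V0 V1 _ _ _ _ _ _ β hd hW htop ε hε
    refine ⟨Unit, inferInstance, inferInstance, fun _ _ => 0, ?_⟩
    have h0 : Subsingleton V0 := finrank_zero_iff.mp (Nat.le_zero.mp hd)
    have h1 : EW β ⊤ = ⊥ := by
      unfold EW
      rw [iSup_eq_bot]
      intro e
      rw [Submodule.eq_bot_iff]
      rintro _ ⟨x, _, rfl⟩
      rw [Subsingleton.elim x 0, map_zero]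
    rw [h1] at htop
    have h2 : finrank K V1 = 0 := by
      rw [← finrank_top K V1, ← htop, finrank_bot]
    rw [co_eq, finrank_pi_fintype, finrank_pi_fintype]
    have h3 := Submodule.finrank_le (LinearMap.ker (act β (fun (_ : Unit) (_ : Unit) => (0 : E))))
    rw [finrank_pi_fintype] at h3
    simp [h2] at h3 ⊢
    have : finrank K V0 = 0 := Nat.le_zero.mp hd
    rw [this] at h3
    have h4 : finrank K (LinearMap.ker (act β (fun (_ : Unit) (_ : Unit) => (0 : E)))) = 0 := by omega
    rw [h4, this]
    simp [hε.le]
  | succ d ih =>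
    intro V0 V1 _ _ _ _ _ _ β hd hW htop ε0 hε0
    by_contra hcon
    push Not at hcon
    have hV0 : finrank K V0 ≠ 0 := by
      intro h
      -- then the statement for smaller d applies
      obtain ⟨ι, i1, i2, h, hh⟩ := ih V0 V1 β (by omega) hW htop ε0 hε0
      exact absurd hh (not_le.mpr (hcon ι i1 i2 h))
    have hbot : (⊥ : Submodule K V0) ≠ ⊤ := by
      intro h
      apply hV0
      rw [← finrank_top K V0, ← h, finrank_bot]
    have hd01 : finrank K V1 + 1 ≤ finrank K V0 := by
      have := hW ⊥ hbot
      have h2 : EW β ⊥ = ⊥ := by simp [EW]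
      rw [h2, finrank_bot, finrank_bot] at this
      omega
    let X : Set ℝ := {x | ∃ (ι : Type) (_ : Fintype ι) (_ : Nonempty ι) (h : ι → ι → E),
      x = co (act β h) / Fintype.card ι}
    have hXb : BddBelow X := by
      refine ⟨ε0, ?_⟩
      rintro _ ⟨ι, i1, i2, h, rfl⟩
      have hc : (0:ℝ) < Fintype.card ι := by exact_mod_cast Fintype.card_pos
      rw [le_div_iff₀ hc]
      exact (hcon ι i1 i2 h).le
    have hXn : X.Nonempty := ⟨_, Unit, inferInstance, inferInstance, fun _ _ => 0, rfl⟩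
    set ρ := sInf X with hρ
    have hρ0 : ε0 ≤ ρ := by
      refine le_csInf hXn ?_
      rintro _ ⟨ι, i1, i2, h, rfl⟩
      have hc : (0:ℝ) < Fintype.card ι := by exact_mod_cast Fintype.card_pos
      rw [le_div_iff₀ hc]
      exact (hcon ι i1 i2 h).le
    have hlow : ∀ (ι : Type) [Fintype ι] [Nonempty ι] (h : ι → ι → E),
        ρ * Fintype.card ι ≤ co (act β h) := by
      intro ι _ _ h
      have hc : (0:ℝ) < Fintype.card ι := by exact_mod_cast Fintype.card_pos
      rw [← le_div_iff₀ hc]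
      exact csInf_le hXb ⟨ι, inferInstance, inferInstance, h, rfl⟩
    have hd0 : (0:ℝ) < finrank K V0 := by exact_mod_cast Nat.pos_of_ne_zero hV0
    obtain ⟨ε, hε, hε1, hε2⟩ : ∃ ε : ℝ, 0 < ε ∧ 3 * ε < ρ ∧ 2 * ε * finrank K V0 < 1 := by
      refine ⟨min (ρ / 4) (1 / (4 * finrank K V0)), ?_, ?_, ?_⟩
      · have : 0 < ρ := by linarith
        positivity
      · have := min_le_left (ρ / 4) (1 / (4 * (finrank K V0 : ℝ)))
        linarith
      · have := min_le_right (ρ / 4) (1 / (4 * (finrank K V0 : ℝ)))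
        have h2 : 1 / (4 * (finrank K V0 : ℝ)) * finrank K V0 = 1 / 4 := by field_simp
        nlinarith
    obtain ⟨_, ⟨ι, i1, i2, h, rfl⟩, hh⟩ := exists_lt_of_csInf_lt hXn
      (show sInf X < ρ + ε by linarith)
    have hc : (0:ℝ) < Fintype.card ι := by exact_mod_cast Fintype.card_pos
    rw [div_lt_iff₀ hc] at hh
    set n : ℝ := ((Fintype.card ι : ℕ) : ℝ) with hn
    set U := LinearMap.ker (act β h) with hU
    obtain ⟨Ws, hWs1, hWs2⟩ := exists_core U (2 * ε * n) (by positivity)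
    have hUn : n ≤ finrank K U := by
      have h1 := co_eq (act β h)
      have h2 := co_nonneg (act β h)
      rw [finrank_pi_fintype, finrank_pi_fintype] at h1
      simp at h1
      have h3 : (finrank K V1 : ℝ) + 1 ≤ finrank K V0 := by exact_mod_cast hd01
      nlinarith
    have hWs0 : Ws ≠ ⊥ := by
      rintro rfl
      have h1 : (U ⊓ Submodule.pi Set.univ (fun _ => (⊥ : Submodule K V0)) :
          Submodule K (ι → V0)) = ⊥ := by simp [Submodule.pi_univ_bot]
      rw [h1, finrank_bot] at hWs1
      simp at hWs1
      nlinarith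
    -- induction hypothesis for the quotient
    have hWsr : finrank K Ws ≠ 0 := fun h => hWs0 (Submodule.finrank_eq_zero.mp h)
    have hq0 := Submodule.finrank_quotient_add_finrank Ws
    have hq1 := Submodule.finrank_quotient_add_finrank (EW β Ws)
    obtain ⟨κ, j1, j2, g, hg⟩ := ih (V0 ⧸ Ws) (V1 ⧸ EW β Ws) (qβ β Ws) (by omega) (by
      intro W' hW'
      have h1 : W'.comap Ws.mkQ ≠ ⊤ := by
        intro h
        apply hW'
        rw [← Submodule.map_comap_eq_of_surjective Ws.mkQ_surjective W', h, Submodule.map_top,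
          Submodule.range_mkQ]
      have h2 := hW _ h1
      have h3 := finrank_of_ker_le Ws.mkQ (W'.comap Ws.mkQ) (by
        intro x hx; rw [LinearMap.mem_ker] at hx; simp only [Submodule.mem_comap]; rw [hx]
        exact W'.zero_mem)
      rw [Submodule.map_comap_eq_of_surjective Ws.mkQ_surjective, Submodule.ker_mkQ] at h3
      have h4 := finrank_of_ker_le (EW β Ws).mkQ (EW β (W'.comap Ws.mkQ)) (by
        rw [Submodule.ker_mkQ]
        apply EW_mono
        intro x hx
        simp only [Submodule.mem_comap]
        rw [Submodule.mkQ_apply, (Submodule.Quotient.mk_eq_zero _).mpr hx]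
        exact W'.zero_mem)
      rw [Submodule.ker_mkQ] at h4
      rw [EW_qβ]
      omega) (by
      rw [EW_qβ, Submodule.comap_top, htop, Submodule.map_top, Submodule.range_mkQ]) ε hε
    classical
    obtain ⟨h', hh1, hh2⟩ := co_line β (qβ β Ws) (hpow κ h)
      (fun x y => hpow ι g (Equiv.prodComm κ ι x) (Equiv.prodComm κ ι y))
    rw [co_hpow] at hh1
    rw [co_reindex (qβ β Ws) (Equiv.prodComm κ ι) (hpow ι g), co_hpow] at hh2
    obtain ⟨r, H, U', S, hH, hU', hUr, hS, hSr, hcU⟩ := pair_lemma β (hpow κ h) h'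
    set m : ℝ := ((Fintype.card κ : ℕ) : ℝ) with hm
    have hmpos : 0 < m := by
      have : 0 < Fintype.card κ := Fintype.card_pos
      rw [hm]
      exact_mod_cast this
    have hHlow := hlow _ H
    have hh'low := hlow _ h'
    rw [co_hpow] at hH
    simp only [Fintype.card_sum, Fintype.card_prod, Nat.cast_add, Nat.cast_mul] at hHlow hh'low
    rw [← hm, ← hn] at hHlow hh'low
    rw [← hn] at hh2
    have hmh : m * co (act β h) ≤ m * ((ρ + ε) * n) := by
      apply mul_le_mul_of_nonneg_left hh.le hmpos.le
    have hng : n * co (act (qβ β Ws) g) ≤ n * (ε * m) :=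
      mul_le_mul_of_nonneg_left hg hc.le
    have hr : (r : ℝ) ≤ m * (2 * ε * n) := by nlinarith
    -- the subspace generated by the coordinates
    let W : Submodule K V0 := ⨆ x : κ × ι, U'.map (LinearMap.proj x)
    have hU'W : U' ≤ sl κ (U ⊓ Submodule.pi Set.univ (fun _ => W)) := by
      intro u hu b
      refine ⟨?_, ?_⟩
      · have := hU' hu
        rw [ker_hpow] at this
        exact this b
      · intro i _
        exact Submodule.mem_iSup_of_mem (b, i) ⟨u, hu, rfl⟩
    have hWsW : Ws ≤ W := by
      apply hWs2
      have h1 := Submodule.finrank_mono hU'W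
      rw [finrank_sl] at h1
      rw [ker_hpow, finrank_sl] at hUr
      have h2 : Fintype.card κ * finrank K U ≤ Fintype.card κ *
        finrank K (U ⊓ Submodule.pi Set.univ (fun _ => W) : Submodule K (ι → V0)) + r := by
        rw [← hU] at hUr; omega
      have h3 : m * finrank K U ≤ m *
        finrank K (U ⊓ Submodule.pi Set.univ (fun _ => W) : Submodule K (ι → V0)) + r := by
        rw [hm]; exact_mod_cast h2
      have h4 : m * finrank K U ≤ m * (
        finrank K (U ⊓ Submodule.pi Set.univ (fun _ => W) : Submodule K (ι → V0)) + 2 * ε * n) := by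
        linarith
      exact le_of_mul_le_mul_left h4 hmpos
    have hsing : ∀ (y : κ × ι), ∀ v ∈ EW β W, Pi.single y v ∈ S := by
      intro y v hv
      have h1 : EW β W ≤ S.comap (LinearMap.single K (fun _ : κ × ι => V1) y) := by
        unfold EW
        refine iSup_le fun e => ?_
        rw [Submodule.map_le_iff_le_comap]
        refine iSup_le fun x => ?_
        rintro _ ⟨u, hu, rfl⟩
        simp only [Submodule.mem_comap]
        have h2 := hcU (fun x' y' => if x' = x ∧ y' = y then e else 0) u hu
        convert h2 using 1
        ext y'
        rw [act_apply]
        simp only [LinearMap.single_apply, LinearMap.proj_apply]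
        by_cases hy : y' = y
        · subst hy
          rw [Pi.single_eq_same, Finset.sum_eq_single x]
          · simp
          · intro b _ hb; simp [hb]
          · simp
        · rw [Pi.single_eq_of_ne hy]
          simp [hy]
      exact h1 hv
    have hpi : Submodule.pi Set.univ (fun _ => EW β Ws) ≤ S := by
      intro v hv
      rw [← Finset.univ_sum_single v]
      exact S.sum_mem fun y _ => hsing y _ (EW_mono β hWsW (hv y trivial))
    have hfin := co_le_of_core β Ws h' S hS hpi
    have hco : co (act β h') = ((finrank K (κ × ι → V1) : ℝ) - finrank K S) + r := by
      unfold co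
      rw [hSr]; push_cast; ring
    have hmn : 0 < m * n := by positivity
    nlinarith

end TorsAux

namespace TorsAux
open Module Filter

theorem gordan_perturb {V : Type} [AddCommGroup V] [Module ℚ V] {n : ℕ} (s : Fin (n+1) → V)
    (ψ l : V →ₗ[ℚ] ℚ) (h1 : ∀ i : Fin n, 0 < ψ (s i.succ)) (h0 : ψ (s 0) = 0)
    (hl : 0 < l (s 0)) : ∃ θ : V →ₗ[ℚ] ℚ, ∀ i, 0 < θ (s i) := by
  obtain ⟨ε, hε, he⟩ : ∃ ε : ℚ, 0 < ε ∧ ∀ i : Fin n, ε * |l (s i.succ)| < ψ (s i.succ) := by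
    have : ∀ᶠ ε in nhdsWithin (0:ℚ) (Set.Ioi 0), ∀ i : Fin n, ε * |l (s i.succ)| < ψ (s i.succ) := by
      rw [eventually_all]
      intro i
      apply eventually_nhdsWithin_of_eventually_nhds
      have hc : Continuous fun ε : ℚ => ε * |l (s i.succ)| := by fun_prop
      apply hc.tendsto 0 |>.eventually_lt_const
      simpa using h1 i
    obtain ⟨ε, h, h'⟩ := (this.and self_mem_nhdsWithin).exists
    exact ⟨ε, h', h⟩
  refine ⟨ψ + ε • l, fun i => ?_⟩
  refine Fin.cases ?_ (fun i => ?_) i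
  · simp only [LinearMap.add_apply, LinearMap.smul_apply, h0, smul_eq_mul]
    nlinarith [mul_pos hε hl]
  · simp only [LinearMap.add_apply, LinearMap.smul_apply, smul_eq_mul]
    have := he i
    have h2 := neg_abs_le (l (s i.succ))
    nlinarith

theorem gordan {V : Type} [AddCommGroup V] [Module ℚ V] : ∀ (n : ℕ) (s : Fin n → V),
    (∃ θ : V →ₗ[ℚ] ℚ, ∀ i, 0 < θ (s i)) ∨
    (∃ a : Fin n → ℚ, (∀ i, 0 ≤ a i) ∧ (∃ i, a i ≠ 0) ∧ ∑ i, a i • s i = 0) := by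
  intro n
  induction n with
  | zero => intro s; exact Or.inl ⟨0, fun i => i.elim0⟩
  | succ n ih =>
    intro s
    rcases ih (fun i => s i.succ) with ⟨θ, hθ⟩ | ⟨a, ha, ⟨i, hi⟩, hs⟩
    swap
    · right
      refine ⟨Fin.cons 0 a, ?_, ⟨i.succ, by simpa using hi⟩, ?_⟩
      · intro j; refine Fin.cases ?_ (fun j => ?_) j
        · simp
        · simpa using ha j
      · rw [Fin.sum_univ_succ]; simpa using hs
    by_cases hz : s 0 = 0
    · right
      refine ⟨Fin.cons 1 0, ?_, ⟨0, by simp⟩, ?_⟩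
      · intro j; refine Fin.cases ?_ (fun j => ?_) j <;> simp
      · rw [Fin.sum_univ_succ]; simp [hz]
    rcases lt_trichotomy (θ (s 0)) 0 with h | h | h
    · rcases ih (fun i => s i.succ - (θ (s i.succ) / θ (s 0)) • s 0) with ⟨θ', hθ'⟩ | ⟨a, ha, ⟨i, hi⟩, hs⟩
      · left
        refine gordan_perturb s (θ' - (θ' (s 0) / θ (s 0)) • θ) (-θ) ?_ ?_ ?_
        · intro i
          have := hθ' i
          simp only [map_sub, map_smul, smul_eq_mul, LinearMap.sub_apply, LinearMap.smul_apply] at this ⊢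
          convert this using 2
          ring
        · simp only [LinearMap.sub_apply, LinearMap.smul_apply, smul_eq_mul]
          rw [div_mul_cancel₀ _ h.ne, sub_self]
        · simpa using h
      · right
        refine ⟨Fin.cons (-∑ i, a i * (θ (s i.succ) / θ (s 0))) a, ?_, ⟨i.succ, by simpa using hi⟩, ?_⟩
        · intro j; refine Fin.cases ?_ (fun j => ?_) j
          · simp only [Fin.cons_zero, Left.nonneg_neg_iff]
            apply Finset.sum_nonpos
            intro i _
            exact mul_nonpos_of_nonneg_of_nonpos (ha i)
              (div_nonpos_of_nonneg_of_nonpos (hθ i).le h.le)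
          · simpa using ha j
        · rw [Fin.sum_univ_succ]
          simp only [Fin.cons_zero, Fin.cons_succ]
          simp only [smul_sub, Finset.sum_sub_distrib, smul_smul] at hs
          rw [← Finset.sum_smul] at hs
          rw [neg_smul, ← hs]
          abel
    · left
      obtain ⟨l, hl⟩ : ∃ l : V →ₗ[ℚ] ℚ, l (s 0) ≠ 0 := by
        by_contra hcon
        push Not at hcon
        exact hz ((Module.forall_dual_apply_eq_zero_iff ℚ (s 0)).mp hcon)
      refine gordan_perturb s θ ((l (s 0)) • l) hθ h ?_
      simp only [LinearMap.smul_apply, smul_eq_mul]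
      exact mul_self_pos.mpr hl
    · left
      refine ⟨θ, fun i => ?_⟩
      refine Fin.cases h (fun i => hθ i) i

/-- Integral version. -/
theorem gordan_int {τ : Type} [Fintype τ] [DecidableEq τ] {n : ℕ} (s : Fin n → τ → ℤ) :
    (∃ θ : τ → ℤ, ∀ i, 0 < ∑ j, θ j * s i j) ∨
    (∃ a : Fin n → ℕ, (∃ i, a i ≠ 0) ∧ ∀ j, ∑ i, (a i : ℤ) * s i j = 0) := by
  have clear : ∀ {σ : Type} [Fintype σ] (q : σ → ℚ), ∃ (D : ℕ) (z : σ → ℤ), 0 < D ∧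
      ∀ i, (z i : ℚ) = D * q i := by
    intro σ _ q
    refine ⟨∏ i, (q i).den, ?_⟩
    have : ∀ i, ∃ z : ℤ, (z : ℚ) = (∏ i, (q i).den : ℕ) * q i := by
      intro i
      obtain ⟨c, hc⟩ := Finset.dvd_prod_of_mem (fun i => (q i).den) (Finset.mem_univ i)
      refine ⟨c * (q i).num, ?_⟩
      rw [hc]
      push_cast
      have := Rat.mul_den_eq_num (q i)
      rw [← this]
      ring
    choose z hz using this
    exact ⟨z, Finset.prod_pos fun i _ => (q i).pos, hz⟩
  rcases gordan n (fun i j => (s i j : ℚ) : Fin n → τ → ℚ) with ⟨θ, hθ⟩ | ⟨a, ha, ⟨i0, hi⟩, hs⟩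
  · left
    obtain ⟨D, z, hD, hz⟩ := clear (fun j => θ (Pi.single j 1))
    refine ⟨z, fun i => ?_⟩
    have h1 := hθ i
    have h2 : θ (fun j => (s i j : ℚ)) = ∑ j, θ (Pi.single j 1) * s i j := by
      conv_lhs => rw [pi_eq_sum_univ' (fun j => (s i j : ℚ))]
      rw [map_sum]
      refine Finset.sum_congr rfl fun j _ => ?_
      rw [map_smul, smul_eq_mul, mul_comm]
    have h3 : ((∑ j, z j * s i j : ℤ) : ℚ) = D * θ (fun j => (s i j : ℚ)) := by
      rw [h2]
      push_cast
      rw [Finset.mul_sum]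
      refine Finset.sum_congr rfl fun j _ => ?_
      rw [hz]; ring
    have h4 : (0:ℚ) < ((∑ j, z j * s i j : ℤ) : ℚ) := by
      rw [h3]
      have : (0:ℚ) < D := by exact_mod_cast hD
      positivity
    exact_mod_cast h4
  · right
    obtain ⟨D, z, hD, hz⟩ := clear a
    have hDq : (0:ℚ) < D := by exact_mod_cast hD
    have hz0 : ∀ i, 0 ≤ z i := by
      intro i
      have : (0:ℚ) ≤ z i := by rw [hz]; exact mul_nonneg hDq.le (ha i)
      exact_mod_cast this
    refine ⟨fun i => (z i).toNat, ⟨i0, ?_⟩, fun j => ?_⟩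
    · have : (z i0 : ℚ) ≠ 0 := by rw [hz]; exact mul_ne_zero hDq.ne' hi
      have h2 : z i0 ≠ 0 := by exact_mod_cast this
      have := hz0 i0
      show (z i0).toNat ≠ 0
      omega
    · have h1 := congrFun hs j
      simp only [Finset.sum_apply, Pi.smul_apply, smul_eq_mul, Pi.zero_apply] at h1
      have h2 : ((∑ i, ((z i).toNat : ℤ) * s i j : ℤ) : ℚ) = D * ∑ i, a i * s i j := by
        rw [Finset.mul_sum]
        push_cast
        refine Finset.sum_congr rfl fun i _ => ?_
        have : (((z i).toNat : ℤ) : ℚ) = z i := by rw [Int.toNat_of_nonneg (hz0 i)]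
        have h5 : (((z i).toNat : ℕ) : ℚ) = z i := by exact_mod_cast this
        rw [h5, hz]; ring
      rw [h1, mul_zero] at h2
      exact_mod_cast h2

end TorsAux

namespace TorsAux
open Module Filter

section Basics
variable {K A : Type} [Field K] [Ring A] [Algebra K A]
variable {P Q R X Y Z : Type}
  [AddCommGroup P] [Module K P] [Module A P] [IsScalarTower K A P]
  [AddCommGroup Q] [Module K Q] [Module A Q] [IsScalarTower K A Q]
  [AddCommGroup R] [Module K R] [Module A R] [IsScalarTower K A R]
  [AddCommGroup X] [Module K X] [Module A X] [IsScalarTower K A X]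
  [AddCommGroup Y] [Module K Y] [Module A Y] [IsScalarTower K A Y]
  [AddCommGroup Z] [Module K Z] [Module A Z] [IsScalarTower K A Z]

instance homFin [Module.Finite K P] [Module.Finite K X] : Module.Finite K (P →ₗ[A] X) := by
  let r : (P →ₗ[A] X) →ₗ[K] (P →ₗ[K] X) :=
    { toFun := fun f => f.restrictScalars K
      map_add' := fun _ _ => rfl
      map_smul' := fun _ _ => rfl }
  refine Module.Finite.of_injective r ?_
  intro f g h
  ext x
  exact LinearMap.congr_fun h x

instance subFin [Module.Finite K X] (N : Submodule A X) : Module.Finite K N :=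
  Module.Finite.of_injective (N.subtype.restrictScalars K) N.injective_subtype

instance quotFin [Module.Finite K X] (N : Submodule A X) : Module.Finite K (X ⧸ N) :=
  Module.Finite.of_surjective (N.mkQ.restrictScalars K) N.mkQ_surjective

variable (K) in
/-- precomposition -/
def pre (X : Type) [AddCommGroup X] [Module K X] [Module A X] [IsScalarTower K A X]
    (h : P →ₗ[A] Q) : (Q →ₗ[A] X) →ₗ[K] (P →ₗ[A] X) where
  toFun φ := φ.comp h
  map_add' _ _ := rfl
  map_smul' _ _ := rfl

variable (K) in
/-- postcomposition -/
def post (P : Type) [AddCommGroup P] [Module K P] [Module A P] [IsScalarTower K A P]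
    (f : X →ₗ[A] Y) : (P →ₗ[A] X) →ₗ[K] (P →ₗ[A] Y) where
  toFun φ := f.comp φ
  map_add' φ ψ := by ext; simp
  map_smul' c φ := by
    ext x
    simp only [LinearMap.comp_apply, LinearMap.smul_apply, RingHom.id_apply]
    exact (f.restrictScalars K).map_smul c _

@[simp] theorem pre_apply (h : P →ₗ[A] Q) (φ : Q →ₗ[A] X) : pre K X h φ = φ.comp h := rfl
@[simp] theorem post_apply (f : X →ₗ[A] Y) (φ : P →ₗ[A] X) : post K P f φ = f.comp φ := rfl

variable (K A) in
/-- dimension of Hom -/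
noncomputable abbrev hd (P X : Type) [AddCommGroup P] [Module K P] [Module A P] [IsScalarTower K A P]
    [AddCommGroup X] [Module K X] [Module A X] [IsScalarTower K A X] : ℕ := finrank K (P →ₗ[A] X)

theorem hd_exact [Module.Finite K P] [Module.Finite K X] [Module.Finite K Z] [Module.Projective A P]
    (f : X →ₗ[A] Z) (hf : Function.Surjective f) :
    hd K A P X = hd K A P (LinearMap.ker f) + hd K A P Z := by
  have h1 := LinearMap.finrank_range_add_finrank_ker (post K P f)
  have h2 : LinearMap.range (post K P f) = ⊤ := by
    rw [LinearMap.range_eq_top]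
    intro φ
    obtain ⟨ψ, hψ⟩ := Module.projective_lifting_property f φ hf
    exact ⟨ψ, hψ⟩
  rw [h2, finrank_top] at h1
  have h3 : finrank K (LinearMap.ker (post K P f)) = hd K A P (LinearMap.ker f) := by
    refine LinearEquiv.finrank_eq (LinearEquiv.symm (LinearEquiv.ofBijective
      ((post K P (LinearMap.ker f).subtype).codRestrict _ ?_) ⟨?_, ?_⟩))
    · intro φ
      ext x
      simp
    · intro φ ψ h
      have h' := congrArg Subtype.val h
      ext x
      exact LinearMap.congr_fun h' x
    · rintro ⟨φ, hφ⟩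
      refine ⟨φ.codRestrict _ (fun x => ?_), ?_⟩
      · exact LinearMap.congr_fun hφ x
      · ext x
        rfl
  unfold hd at *
  omega

theorem hd_le_of_inj [Module.Finite K P] [Module.Finite K X] [Module.Finite K Y] (f : X →ₗ[A] Y)
    (hf : Function.Injective f) : hd K A P X ≤ hd K A P Y := by
  refine LinearMap.finrank_le_finrank_of_injective (f := post K P f) ?_
  intro φ ψ h
  ext x
  exact hf (LinearMap.congr_fun h x)

theorem hd_congr [Module.Finite K P] [Module.Finite K X] [Module.Finite K Y] (e : X ≃ₗ[A] Y) :
    hd K A P X = hd K A P Y :=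
  le_antisymm (hd_le_of_inj e.toLinearMap e.injective)
    (hd_le_of_inj e.symm.toLinearMap e.symm.injective)

theorem hd_quot [Module.Finite K P] [Module.Finite K X] [Module.Projective A P] (N : Submodule A X) :
    hd K A P X = hd K A P N + hd K A P (X ⧸ N) := by
  rw [hd_exact N.mkQ N.mkQ_surjective, hd_congr (LinearEquiv.ofEq _ _ N.ker_mkQ)]

theorem hd_prod_left [Module.Finite K P] [Module.Finite K Q] [Module.Finite K X] :
    hd K A (P × Q) X = hd K A P X + hd K A Q X := by
  rw [hd, ← (LinearMap.coprodEquiv (R := A) K (M := P) (M₂ := Q) (M₃ := X)).finrank_eq,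
    finrank_prod]

theorem hd_pi_left {ι : Type} [Fintype ι] [DecidableEq ι] {P : ι → Type} [∀ i, AddCommGroup (P i)]
    [∀ i, Module K (P i)] [∀ i, Module A (P i)] [∀ i, IsScalarTower K A (P i)]
    [∀ i, Module.Finite K (P i)] [Module.Finite K X] :
    hd K A (∀ i, P i) X = ∑ i, hd K A (P i) X := by
  rw [hd, ← (LinearMap.lsum A P K (M := X)).finrank_eq, finrank_pi_fintype]

theorem hd_pi_right {ι : Type} [Fintype ι] {X : ι → Type} [∀ i, AddCommGroup (X i)]
    [∀ i, Module K (X i)] [∀ i, Module A (X i)] [∀ i, IsScalarTower K A (X i)]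
    [∀ i, Module.Finite K (X i)] [Module.Finite K P] :
    hd K A P (∀ i, X i) = ∑ i, hd K A P (X i) := by
  rw [← finrank_pi_fintype K (M := fun i => P →ₗ[A] X i)]
  refine LinearEquiv.finrank_eq (LinearEquiv.ofBijective
    (⟨⟨fun f i => (LinearMap.proj i).comp f, fun _ _ => rfl⟩, fun _ _ => rfl⟩ :
      (P →ₗ[A] ∀ i, X i) →ₗ[K] ∀ i, P →ₗ[A] X i) ⟨?_, ?_⟩)
  · intro f g h
    ext x i
    exact LinearMap.congr_fun (congrFun h i) x
  · intro f
    exact ⟨LinearMap.pi f, rfl⟩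

theorem hd_A [Module.Finite K A] [Module.Finite K X] : hd K A A X = finrank K X :=
  (LinearMap.ringLmapEquivSelf A K X).finrank_eq

theorem hd_zero [Subsingleton X] : hd K A P X = 0 := by
  have : Subsingleton (P →ₗ[A] X) := ⟨fun f g => by ext x; exact Subsingleton.elim _ _⟩
  exact finrank_zero_of_subsingleton

theorem pre_line (f g : P →ₗ[A] Q) (t : K) : pre K X (f + t • g) = pre K X f + t • pre K X g := by
  ext φ x
  simp only [pre_apply, LinearMap.comp_apply, LinearMap.add_apply, LinearMap.smul_apply, map_add]
  congr 1
  exact (φ.restrictScalars K).map_smul t _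

theorem post_line (f g : X →ₗ[A] Y) (t : K) : post K P (f + t • g) = post K P f + t • post K P g := by
  ext φ x
  rfl

end Basics

/-- maximal rank is kept generically: injectivity -/
theorem gen_inj {K U V : Type} [Field K] [AddCommGroup U] [Module K U] [AddCommGroup V] [Module K V]
    [FiniteDimensional K U] [FiniteDimensional K V] (a b : U →ₗ[K] V) (t0 : K)
    (h : Function.Injective (a + t0 • b)) : ∀ᶠ t : K in cofinite, Function.Injective (a + t • b) := by
  filter_upwards [gen_rank a b t0] with t ht
  have h1 := LinearMap.finrank_range_add_finrank_ker (a + t • b)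
  rw [LinearMap.finrank_range_of_inj h] at ht
  rw [← LinearMap.ker_eq_bot, ← Submodule.finrank_eq_zero]
  omega

theorem gen_surj {K U V : Type} [Field K] [AddCommGroup U] [Module K U] [AddCommGroup V] [Module K V]
    [FiniteDimensional K U] [FiniteDimensional K V] (a b : U →ₗ[K] V) (t0 : K)
    (h : Function.Surjective (a + t0 • b)) :
    ∀ᶠ t : K in cofinite, Function.Surjective (a + t • b) := by
  filter_upwards [gen_rank a b t0] with t ht
  rw [LinearMap.range_eq_top.mpr h, finrank_top] at ht
  rw [← LinearMap.range_eq_top]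
  exact Submodule.eq_top_of_finrank_eq (le_antisymm (Submodule.finrank_le _) ht)

end TorsAux

namespace TorsAux
open Module Filter

set_option linter.unusedSectionVars false

section Decomp
variable (K A : Type) [Field K] [Ring A] [Algebra K A] [FiniteDimensional K A]

/-- hereditary -/
def Hered (A : Type) [Ring A] : Prop :=
  ∀ (P : Type) [AddCommGroup P] [Module A P], Module.Finite A P → Module.Projective A P →
    ∀ N : Submodule A P, Module.Projective A N

/-- only trivial idempotent endomorphisms -/
def Indec (A : Type) [Ring A] (P : Type) [AddCommGroup P] [Module A P] : Prop :=
  ∀ e : P →ₗ[A] P, e.comp e = e → e = 0 ∨ e = LinearMap.id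

variable {K A}

theorem indec_inj (H : Hered A) {P Q : Type} [AddCommGroup P] [Module A P] [AddCommGroup Q] [Module A Q]
    [Module.Finite A Q] [Module.Projective A Q] (hP : Indec A P) (f : P →ₗ[A] Q) (hf : f ≠ 0) :
    Function.Injective f := by
  have hp : Module.Projective A (LinearMap.range f) := H Q inferInstance inferInstance _
  obtain ⟨s, hs⟩ := Module.projective_lifting_property f.rangeRestrict LinearMap.id
    f.surjective_rangeRestrict
  have hs' : ∀ y, f.rangeRestrict (s y) = y := fun y => LinearMap.congr_fun hs y
  rcases hP (s.comp f.rangeRestrict) (by ext x; simp [hs']) with h | h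
  · exfalso
    apply hf
    ext x
    have h1 := LinearMap.congr_fun h x
    have h2 := hs' (f.rangeRestrict x)
    simp only [LinearMap.comp_apply, LinearMap.zero_apply] at h1
    rw [h1, map_zero] at h2
    exact (congrArg Subtype.val h2).symm
  · intro x y hxy
    have h1 : f.rangeRestrict x = f.rangeRestrict y := Subtype.ext hxy
    have hx := LinearMap.congr_fun h x
    have hy := LinearMap.congr_fun h y
    simp only [LinearMap.comp_apply, LinearMap.id_apply] at hx hy
    rw [← hx, ← hy, h1]

theorem decomp_sub (d : ℕ) : ∀ U : Submodule A A, finrank K U ≤ d →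
    ∃ (ι : Type) (_ : Fintype ι) (Q : ι → Submodule A A) (b : ι → U →ₗ[A] A),
      (∀ i, Indec A (Q i)) ∧ (∀ i u, b i u ∈ Q i) ∧ ∀ u, ∑ i, b i u = u := by
  induction d with
  | zero =>
    intro U hU
    have : Subsingleton U := finrank_zero_iff.mp (Nat.le_zero.mp hU)
    refine ⟨Empty, inferInstance, Empty.elim, fun i => i.elim, fun i => i.elim, fun i => i.elim, ?_⟩
    intro u
    rw [Subsingleton.elim u 0]
    simp
  | succ d ih =>
    intro U hU
    by_cases hi : Indec A U
    · exact ⟨Unit, inferInstance, fun _ => U, fun _ => U.subtype, fun _ => hi, fun _ u => u.2, by simp⟩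
    unfold Indec at hi
    push Not at hi
    obtain ⟨e, he, he0, he1⟩ := hi
    have hee : ∀ x, e (e x) = e x := fun x => LinearMap.congr_fun he x
    have key : ∀ e : U →ₗ[A] U, (∀ x, e (e x) = e x) → e ≠ LinearMap.id →
        finrank K ((LinearMap.range e).map U.subtype) ≤ d := by
      intro e he hne
      have h1 : (LinearMap.range e) ≠ ⊤ := by
        intro h
        apply hne
        ext x
        obtain ⟨y, rfl⟩ := LinearMap.range_eq_top.mp h x
        simp [he]
      have h2 : finrank K (LinearMap.range e) < finrank K U := by
        have : finrank K ((LinearMap.range e).restrictScalars K) < finrank K U := by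
          apply Submodule.finrank_lt
          intro h
          apply h1
          exact (Submodule.restrictScalars_eq_top_iff K A _).mp h
        exact this
      have h3 : finrank K ((LinearMap.range e).map U.subtype) = finrank K (LinearMap.range e) :=
        (((LinearMap.range e).equivMapOfInjective U.subtype U.injective_subtype).restrictScalars
          K).finrank_eq.symm
      omega
    obtain ⟨ι1, _, Q1, b1, hQ1, hb1, hs1⟩ := ih _ (key e hee he1)
    obtain ⟨ι2, _, Q2, b2, hQ2, hb2, hs2⟩ := ih _ (key (LinearMap.id - e) (by
      intro x; simp [hee]) (by
      intro h
      apply he0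
      ext x
      have := LinearMap.congr_fun h x
      simp at this
      simp [this]))
    let p : ∀ e : U →ₗ[A] U, U →ₗ[A] ((LinearMap.range e).map U.subtype) := fun e =>
      (U.subtype.comp e).codRestrict _ (fun x => ⟨e x, ⟨x, rfl⟩, rfl⟩)
    refine ⟨ι1 ⊕ ι2, inferInstance, Sum.elim Q1 Q2, Sum.elim (fun i => (b1 i).comp (p e))
      (fun i => (b2 i).comp (p (LinearMap.id - e))), ?_, ?_, ?_⟩
    · rintro (i | i)
      · exact hQ1 i
      · exact hQ2 i
    · rintro (i | i) u
      · exact hb1 i _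
      · exact hb2 i _
    · intro u
      rw [Fintype.sum_sum_type]
      simp only [Sum.elim_inl, Sum.elim_inr, LinearMap.comp_apply]
      rw [hs1, hs2]
      show (e u : A) + (((LinearMap.id - e : U →ₗ[A] U) u : U) : A) = u
      simp

variable (A) in
/-- decomposition data of the regular module -/
structure Dec (ι : Type) [Fintype ι] where
  Q : ι → Submodule A A
  b : ∀ i, A →ₗ[A] Q i
  ind : ∀ i, Indec A (Q i)
  sum : ∀ x : A, ∑ i, (b i x : A) = x

theorem exists_dec (K A : Type) [Field K] [Ring A] [Algebra K A] [FiniteDimensional K A] : ∃ (ι : Type) (_ : Fintype ι), Nonempty (Dec A ι) := by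
  obtain ⟨ι, _, Q, b, h1, h2, h3⟩ := decomp_sub (K := K) (A := A) (finrank K (⊤ : Submodule A A)) ⊤ le_rfl
  refine ⟨ι, inferInstance, ⟨⟨Q, fun i => ((b i).comp Submodule.topEquiv.symm.toLinearMap).codRestrict _
    (fun u => h2 i _), h1, fun x => ?_⟩⟩⟩
  exact h3 ⟨x, trivial⟩

variable {ι : Type} [Fintype ι] (D : Dec A ι)

theorem Dec.F1 {X : Type} [AddCommGroup X] [Module A X] (x : X) (hx : x ≠ 0) :
    ∃ (i : ι) (f : D.Q i →ₗ[A] X), f ≠ 0 := by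
  by_contra hcon
  push Not at hcon
  apply hx
  have h := D.sum 1
  have h2 : (LinearMap.toSpanSingleton A X x) (∑ i, (D.b i 1 : A)) = x := by
    rw [h]; simp
  rw [← h2, map_sum]
  refine Finset.sum_eq_zero fun i _ => ?_
  exact LinearMap.congr_fun (hcon i ((LinearMap.toSpanSingleton A X x).comp (D.Q i).subtype)) _

theorem Dec.factor {R W : Type} [AddCommGroup R] [Module A R] [AddCommGroup W] [Module A W]
    [Module.Finite A R] [Module.Projective A R] (f : W →ₗ[A] R) (hf : f ≠ 0) :
    ∃ (j : ι) (a : D.Q j →ₗ[A] R) (b : R →ₗ[A] D.Q j), a.comp (b.comp f) ≠ 0 := by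
  obtain ⟨m, r, hr⟩ := Module.Finite.exists_fin' A R
  obtain ⟨s, hs⟩ := Module.projective_lifting_property r LinearMap.id hr
  by_contra hcon
  push Not at hcon
  apply hf
  ext w
  have h1 : r (s (f w)) = f w := LinearMap.congr_fun hs _
  rw [LinearMap.zero_apply, ← h1]
  have h2 : s (f w) = ∑ k, ∑ j, Pi.single k (D.b j (s (f w) k) : A) := by
    conv_lhs => rw [← Finset.univ_sum_single (s (f w))]
    refine Finset.sum_congr rfl fun k _ => ?_
    conv_lhs => rw [← D.sum (s (f w) k)]
    exact map_sum (LinearMap.single A (fun _ : Fin m => A) k) _ _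
  rw [h2]
  simp only [map_sum]
  refine Finset.sum_eq_zero fun k _ => Finset.sum_eq_zero fun j _ => ?_
  exact LinearMap.congr_fun (hcon j (r.comp ((LinearMap.single A (fun _ : Fin m => A) k).comp
    (D.Q j).subtype)) ((D.b j).comp ((LinearMap.proj k).comp s))) w

variable (K) in
theorem Dec.split (H : Hered A) {R : Type} [AddCommGroup R] [Module A R]
    [Module.Finite A R] [Module.Projective A R] (i : ι) (f : D.Q i →ₗ[A] R) (hf : f ≠ 0)
    (hmax : ∀ j, (∃ g : D.Q j →ₗ[A] R, g ≠ 0) → finrank K (D.Q j) ≤ finrank K (D.Q i)) :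
    ∃ (b : R →ₗ[A] D.Q i), b.comp f = LinearMap.id := by
  obtain ⟨j, a, b, hab⟩ := D.factor f hf
  have hb : b.comp f ≠ 0 := by
    intro h; apply hab; rw [h]; simp
  have ha : a ≠ 0 := by
    intro h; apply hab; rw [h]; simp
  have hpj : Module.Projective A (D.Q j) := H A inferInstance inferInstance _
  have : Module.Finite A (D.Q j) := Module.Finite.of_restrictScalars_finite K A _
  have hinj := indec_inj H (D.ind i) _ hb
  have hle := hmax j ⟨a, ha⟩
  have hbij : Function.Bijective (b.comp f) := by
    refine ⟨hinj, ?_⟩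
    have h2 : finrank K (D.Q i) = finrank K (D.Q j) := le_antisymm
      (LinearMap.finrank_le_finrank_of_injective (f := (b.comp f).restrictScalars K) hinj) hle
    exact (LinearMap.injective_iff_surjective_of_finrank_eq_finrank
      (f := (b.comp f).restrictScalars K) h2).mp hinj
  refine ⟨(LinearEquiv.ofBijective _ hbij).symm.toLinearMap.comp b, ?_⟩
  ext x
  simp only [LinearMap.comp_apply, LinearEquiv.coe_coe, LinearMap.id_apply]
  congr 1
  exact (LinearEquiv.ofBijective _ hbij).symm_apply_apply x

/-- complement of a split mono -/
theorem split_equiv {R Q : Type} [AddCommGroup R] [Module A R] [AddCommGroup Q] [Module A Q]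
    (f : Q →ₗ[A] R) (b : R →ₗ[A] Q) (h : b.comp f = LinearMap.id) :
    Nonempty (R ≃ₗ[A] (LinearMap.ker b × Q)) := by
  have h' : ∀ x, b (f x) = x := fun x => LinearMap.congr_fun h x
  refine ⟨LinearEquiv.symm (LinearEquiv.ofBijective ((LinearMap.ker b).subtype.coprod f) ⟨?_, ?_⟩)⟩
  · rw [← LinearMap.ker_eq_bot, Submodule.eq_bot_iff]
    rintro ⟨⟨k, hk⟩, q⟩ hx
    simp only [LinearMap.mem_ker, LinearMap.coprod_apply, Submodule.subtype_apply] at hx hk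
    have h1 := congrArg b hx
    rw [map_add, hk, h', zero_add, map_zero] at h1
    subst h1
    simp only [map_zero, add_zero] at hx
    subst hx
    rfl
  · intro x
    refine ⟨(⟨x - f (b x), by simp [h']⟩, b x), by simp⟩

theorem Dec.F3 (H : Hered A) (d : ℕ) : ∀ (R R' : Type) [AddCommGroup R] [Module K R] [Module A R]
    [IsScalarTower K A R] [Module.Finite K R] [AddCommGroup R'] [Module K R'] [Module A R']
    [IsScalarTower K A R'] [Module.Finite K R'] [Module.Projective A R] [Module.Projective A R'],
    finrank K R ≤ d → (∀ i, hd K A (D.Q i) R = hd K A (D.Q i) R') → Nonempty (R ≃ₗ[A] R') := by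
  have hnz : ∀ (R : Type) [AddCommGroup R] [Module K R] [Module A R] [IsScalarTower K A R]
      [Module.Finite K R] (i : ι), hd K A (D.Q i) R ≠ 0 ↔ ∃ f : D.Q i →ₗ[A] R, f ≠ 0 := by
    intro R _ _ _ _ _ i
    rw [hd, ← Nat.pos_iff_ne_zero, Module.finrank_pos_iff_exists_ne_zero]
  have hp : ∀ j, Module.Projective A (D.Q j) := fun j => H A inferInstance inferInstance _
  induction d with
  | zero =>
    intro R R' _ _ _ _ _ _ _ _ _ _ _ _ hd0 he
    have h0 : Subsingleton R := finrank_zero_iff.mp (Nat.le_zero.mp hd0)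
    have h1 : Subsingleton R' := by
      by_contra hcon
      rw [not_subsingleton_iff_nontrivial] at hcon
      obtain ⟨x, hx⟩ := exists_ne (0 : R')
      obtain ⟨i, hi⟩ := D.F1 x hx
      rw [← hnz, ← he, hd_zero] at hi
      exact hi rfl
    exact ⟨0⟩
  | succ d ih =>
    intro R R' _ _ _ _ _ _ _ _ _ _ _ _ hd0 he
    by_cases hR : finrank K R = 0
    · exact ih R R' (by omega) he
    have : Nontrivial R := by
      apply Module.nontrivial_of_finrank_pos (R := K); omega
    obtain ⟨x, hx⟩ := exists_ne (0 : R)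
    obtain ⟨i0, hi0⟩ := D.F1 x hx
    rw [← hnz] at hi0
    classical
    obtain ⟨i, hi, hmax⟩ := Finset.exists_max_image
      (Finset.univ.filter fun i => hd K A (D.Q i) R ≠ 0) (fun i => finrank K (D.Q i))
      ⟨i0, by simpa using hi0⟩
    simp only [Finset.mem_filter, Finset.mem_univ, true_and] at hi hmax
    have hi' := hi
    rw [he] at hi'
    have fR : Module.Finite A R := Module.Finite.of_restrictScalars_finite K A _
    have fR' : Module.Finite A R' := Module.Finite.of_restrictScalars_finite K A _
    obtain ⟨f, hf⟩ := (hnz R i).mp hi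
    obtain ⟨f', hf'⟩ := (hnz R' i).mp hi'
    obtain ⟨b, hb⟩ := D.split K H i f hf (fun j hj => hmax j ((hnz R j).mpr hj))
    obtain ⟨b', hb'⟩ := D.split K H i f' hf' (fun j hj => hmax j (by
      rw [he]; exact (hnz R' j).mpr hj))
    have sb : Function.Surjective b := fun q => ⟨f q, LinearMap.congr_fun hb q⟩
    have sb' : Function.Surjective b' := fun q => ⟨f' q, LinearMap.congr_fun hb' q⟩
    have pk : Module.Projective A (LinearMap.ker b) := H R inferInstance inferInstance _
    have pk' : Module.Projective A (LinearMap.ker b') := H R' inferInstance inferInstance _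
    obtain ⟨e1⟩ := split_equiv f b hb
    obtain ⟨e2⟩ := split_equiv f' b' hb'
    obtain ⟨e⟩ := ih (LinearMap.ker b) (LinearMap.ker b') (by
      have h1 := (e1.restrictScalars K).finrank_eq
      rw [finrank_prod] at h1
      have h2 : 0 < finrank K (D.Q i) := by
        rw [Module.finrank_pos_iff_exists_ne_zero]
        by_contra hcon
        push Not at hcon
        apply hf
        ext x
        rw [hcon x]; simp
      omega) (by
      intro j
      have h1 := hd_exact (K := K) (P := D.Q j) b sb
      have h2 := hd_exact (K := K) (P := D.Q j) b' sb'
      have h3 := he j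
      omega)
    exact ⟨e1.trans ((e.prodCongr (LinearEquiv.refl A _)).trans e2.symm)⟩

end Decomp
end TorsAux

namespace TorsAux
open Module Filter

set_option linter.unusedSectionVars false

section Generic
variable {K A : Type} [Field K] [Infinite K] [Ring A] [Algebra K A] [FiniteDimensional K A]
variable {M N R0 R1 X Y : Type}
  [AddCommGroup M] [Module K M] [Module A M] [IsScalarTower K A M] [Module.Finite K M]
  [AddCommGroup N] [Module K N] [Module A N] [IsScalarTower K A N] [Module.Finite K N]
  [AddCommGroup R0] [Module K R0] [Module A R0] [IsScalarTower K A R0] [Module.Finite K R0]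
  [AddCommGroup R1] [Module K R1] [Module A R1] [IsScalarTower K A R1] [Module.Finite K R1]
  [AddCommGroup X] [Module K X] [Module A X] [IsScalarTower K A X] [Module.Finite K X]
  [AddCommGroup Y] [Module K Y] [Module A Y] [IsScalarTower K A Y] [Module.Finite K Y]

theorem generic_coker (K : Type) {A : Type} [Field K] [Infinite K] [Ring A] [Algebra K A]
    [FiniteDimensional K A] {M N R0 R1 : Type}
    [AddCommGroup M] [Module K M] [Module A M] [IsScalarTower K A M] [Module.Finite K M]
    [AddCommGroup N] [Module K N] [Module A N] [IsScalarTower K A N] [Module.Finite K N]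
    [AddCommGroup R0] [Module K R0] [Module A R0] [IsScalarTower K A R0] [Module.Finite K R0]
    [AddCommGroup R1] [Module K R1] [Module A R1] [IsScalarTower K A R1] [Module.Finite K R1]
    (f g : R1 →ₗ[A] R0) (hf : Function.Injective f) (hg : Function.Injective g)
    (hfN : ∀ φ : R0 →ₗ[A] N, φ.comp f = 0 → φ = 0)
    (hgM : ∀ w : M →ₗ[A] R0 ⧸ LinearMap.range g, w = 0) :
    ∃ h : R1 →ₗ[A] R0, Function.Injective h ∧ (∀ φ : R0 →ₗ[A] N, φ.comp h = 0 → φ = 0) ∧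
      ∀ w : M →ₗ[A] R0 ⧸ LinearMap.range h, w = 0 := by
  have fM : Module.Finite A M := Module.Finite.of_restrictScalars_finite K A _
  obtain ⟨k, π, hπ⟩ := Module.Finite.exists_fin' A M
  set p := (LinearMap.ker π).subtype with hp
  let Dm : (R1 →ₗ[A] R0) → ((LinearMap.ker π →ₗ[A] R1) × ((Fin k → A) →ₗ[A] R0)) →ₗ[K]
      (LinearMap.ker π →ₗ[A] R0) := fun h =>
    (post K (LinearMap.ker π) h).comp (LinearMap.fst K _ _) - (pre K R0 p).comp (LinearMap.snd K _ _)
  have hDm : ∀ h u, Dm h u = h.comp u.1 - u.2.comp p := fun h u => rfl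
  let j : (R1 →ₗ[A] R0) → ((Fin k → A) →ₗ[A] R1) →ₗ[K]
      ((LinearMap.ker π →ₗ[A] R1) × ((Fin k → A) →ₗ[A] R0)) := fun h =>
    (pre K R1 p).prod (post K _ h)
  have hj : ∀ h s, j h s = (s.comp p, h.comp s) := fun h s => rfl
  have jinj : ∀ h : R1 →ₗ[A] R0, Function.Injective h → Function.Injective (j h) := by
    intro h hh s s' hs
    have := congrArg Prod.snd hs
    refine LinearMap.ext fun x => ?_
    simp only [hj] at this
    exact hh (LinearMap.congr_fun this x)
  have jker : ∀ h, LinearMap.range (j h) ≤ LinearMap.ker (Dm h) := by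
    rintro h _ ⟨s, rfl⟩
    rw [LinearMap.mem_ker, hDm, hj]
    rw [LinearMap.comp_assoc, sub_self]
  -- at g equality
  have eqg : LinearMap.ker (Dm g) ≤ LinearMap.range (j g) := by
    rintro ⟨u, v⟩ huv
    rw [LinearMap.mem_ker, hDm, sub_eq_zero] at huv
    simp only at huv
    have hv : ∀ x, v x ∈ LinearMap.range g := by
      have h1 : LinearMap.ker π ≤ LinearMap.ker ((LinearMap.range g).mkQ.comp v) := by
        intro x hx
        have h2 := LinearMap.congr_fun huv ⟨x, hx⟩
        simp only [LinearMap.comp_apply, hp, Submodule.subtype_apply] at h2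
        simp only [LinearMap.mem_ker, LinearMap.comp_apply, Submodule.mkQ_apply,
          Submodule.Quotient.mk_eq_zero]
        exact ⟨_, h2⟩
      have h3 := hgM (((LinearMap.ker π).liftQ _ h1).comp
        (π.quotKerEquivOfSurjective hπ).symm.toLinearMap)
      intro x
      have h4 := LinearMap.congr_fun h3 (π x)
      have h5 : (π.quotKerEquivOfSurjective hπ).symm (π x) = (LinearMap.ker π).mkQ x := by
        rw [LinearEquiv.symm_apply_eq]; rfl
      simp only [LinearMap.comp_apply, LinearEquiv.coe_coe, h5] at h4
      simpa using h4
    let e := LinearEquiv.ofInjective g hg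
    let s : (Fin k → A) →ₗ[A] R1 := e.symm.toLinearMap.comp (v.codRestrict _ hv)
    have hs : ∀ x, g (s x) = v x := by
      intro x
      have : e (s x) = (v.codRestrict _ hv) x := e.apply_symm_apply _
      exact congrArg Subtype.val this
    refine ⟨s, ?_⟩
    rw [hj]
    refine Prod.ext ?_ ?_
    · ext x
      apply hg
      have := LinearMap.congr_fun huv x
      simp only [LinearMap.comp_apply] at this ⊢
      rw [hs, this]
    · exact LinearMap.ext hs
  have line : ∀ t : K, Dm (f + t • (g - f)) = Dm f + t • (post K _ (g - f)).comp (LinearMap.fst K _ _) := by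
    intro t
    simp only [Dm]
    rw [post_line]
    ext <;> simp
  have e1 := gen_rank (Dm f) ((post K _ (g - f)).comp (LinearMap.fst K _ _)) 1
  have e2 := gen_inj (f.restrictScalars K) ((g - f).restrictScalars K) 0 (by simpa using hf)
  have e3 := gen_inj (pre K N f) (pre K N (g - f)) 0 (by
    rw [zero_smul, add_zero, ← LinearMap.ker_eq_bot, Submodule.eq_bot_iff]
    exact fun φ hφ => hfN φ hφ)
  obtain ⟨t, ⟨h1, h2⟩, h3⟩ := ((e1.and e2).and e3).exists
  rw [← line, ← line, one_smul, add_sub_cancel] at h1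
  rw [← pre_line] at h3
  set h := f + t • (g - f) with hh
  have hi : Function.Injective h := h2
  refine ⟨h, hi, ?_, ?_⟩
  · intro φ hφ
    apply h3
    rw [map_zero]
    exact hφ
  · have hk : LinearMap.range (j h) = LinearMap.ker (Dm h) := by
      apply Submodule.eq_of_le_of_finrank_le (jker h)
      have a1 := LinearMap.finrank_range_add_finrank_ker (Dm h)
      have a2 := LinearMap.finrank_range_add_finrank_ker (Dm g)
      have a3 := Submodule.finrank_mono eqg
      rw [LinearMap.finrank_range_of_inj (jinj g hg)] at a3
      rw [LinearMap.finrank_range_of_inj (jinj h hi)]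
      omega
    intro w
    obtain ⟨v, hv⟩ := Module.projective_lifting_property (LinearMap.range h).mkQ (w.comp π)
      (Submodule.mkQ_surjective _)
    have hvr : ∀ x : LinearMap.ker π, v (p x) ∈ LinearMap.range h := by
      intro x
      have := LinearMap.congr_fun hv (p x)
      simp only [LinearMap.comp_apply] at this
      rw [show π (p x) = 0 from x.2, map_zero] at this
      simpa using this
    let e := LinearEquiv.ofInjective h hi
    let u : LinearMap.ker π →ₗ[A] R1 := e.symm.toLinearMap.comp ((v.comp p).codRestrict _ hvr)
    have hu : ∀ x, h (u x) = v (p x) := by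
      intro x
      have : e (u x) = ((v.comp p).codRestrict _ hvr) x := e.apply_symm_apply _
      exact congrArg Subtype.val this
    have hm : ((u, v) : (LinearMap.ker π →ₗ[A] R1) × ((Fin k → A) →ₗ[A] R0)) ∈ LinearMap.range (j h) := by
      rw [hk, LinearMap.mem_ker, hDm, sub_eq_zero]
      exact LinearMap.ext hu
    obtain ⟨s, hs⟩ := hm
    have hs2 : h.comp s = v := congrArg Prod.snd hs
    ext m
    obtain ⟨x, rfl⟩ := hπ m
    have h5 := LinearMap.congr_fun hv x
    simp only [LinearMap.comp_apply] at h5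
    rw [← h5, ← hs2]
    simp

theorem numdisj (H : Hered A) {ι : Type} [Fintype ι] (D : Dec A ι)
    (TF : ∀ (Z : Type) [AddCommGroup Z] [Module A Z], Module.Finite A Z →
      (∀ φ : Z →ₗ[A] N, φ = 0) → (∀ φ : M →ₗ[A] Z, φ = 0) → Subsingleton Z)
    (hX : ∀ φ : X →ₗ[A] N, φ = 0) (hY : ∀ φ : M →ₗ[A] Y, φ = 0)
    (he : ∀ i, hd K A (D.Q i) X = hd K A (D.Q i) Y) : Subsingleton X := by
  have fX : Module.Finite A X := Module.Finite.of_restrictScalars_finite K A _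
  have fY : Module.Finite A Y := Module.Finite.of_restrictScalars_finite K A _
  have hp : ∀ j, Module.Projective A (D.Q j) := fun j => H A inferInstance inferInstance _
  obtain ⟨a, r, hr⟩ := Module.Finite.exists_fin' A X
  obtain ⟨b, s, hs⟩ := Module.Finite.exists_fin' A Y
  let R0 := (Fin a → A) × (Fin b → A)
  let π : R0 →ₗ[A] X := r.comp (LinearMap.fst A _ _)
  let σ : R0 →ₗ[A] Y := s.comp (LinearMap.snd A _ _)
  have hπ : Function.Surjective π := hr.comp Prod.fst_surjective
  have hσ : Function.Surjective σ := hs.comp Prod.snd_surjective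
  have pk : Module.Projective A (LinearMap.ker π) := H R0 inferInstance inferInstance _
  have pk' : Module.Projective A (LinearMap.ker σ) := H R0 inferInstance inferInstance _
  obtain ⟨e⟩ := D.F3 (K := K) H _ (LinearMap.ker π) (LinearMap.ker σ) le_rfl (by
    intro i
    have h1 := hd_exact (K := K) (P := D.Q i) π hπ
    have h2 := hd_exact (K := K) (P := D.Q i) σ hσ
    have h3 := he i
    omega)
  obtain ⟨h, hi, hN, hM⟩ := generic_coker K (M := M) (N := N) (LinearMap.ker π).subtype
    ((LinearMap.ker σ).subtype.comp e.toLinearMap) (Submodule.injective_subtype _)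
    (by simpa using e.injective) (by
      intro φ hφ
      have h1 : LinearMap.ker π ≤ LinearMap.ker φ := fun x hx => LinearMap.congr_fun hφ ⟨x, hx⟩
      have h2 := hX (((LinearMap.ker π).liftQ _ h1).comp
        (π.quotKerEquivOfSurjective hπ).symm.toLinearMap)
      refine LinearMap.ext fun x => ?_
      have h4 := LinearMap.congr_fun h2 (π x)
      have h5 : (π.quotKerEquivOfSurjective hπ).symm (π x) = (LinearMap.ker π).mkQ x := by
        rw [LinearEquiv.symm_apply_eq]; rfl
      simp only [LinearMap.comp_apply, LinearEquiv.coe_coe, h5] at h4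
      simpa using h4) (by
      intro w
      have hr : LinearMap.range ((LinearMap.ker σ).subtype.comp e.toLinearMap) = LinearMap.ker σ := by
        rw [LinearMap.range_comp, LinearEquiv.range, Submodule.map_top, Submodule.range_subtype]
      let q := (Submodule.quotEquivOfEq _ _ hr).trans (σ.quotKerEquivOfSurjective hσ)
      have := hY (q.toLinearMap.comp w)
      ext m
      have h2 := LinearMap.congr_fun this m
      simp only [LinearMap.comp_apply, LinearEquiv.coe_coe, LinearMap.zero_apply] at h2
      rw [q.map_eq_zero_iff] at h2
      simpa using h2)
  have hZ := TF (R0 ⧸ LinearMap.range h) inferInstance (by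
    intro φ
    have := hN (φ.comp (LinearMap.range h).mkQ) (by
      refine LinearMap.ext fun x => ?_
      have : (LinearMap.range h).mkQ (h x) = 0 := by simp
      simp only [LinearMap.comp_apply, this, map_zero, LinearMap.zero_apply])
    refine LinearMap.ext fun x => ?_
    obtain ⟨x, rfl⟩ := Submodule.mkQ_surjective _ x
    exact LinearMap.congr_fun this x) hM
  -- dimension count
  have d1 : finrank K (LinearMap.range h) = finrank K R0 := by
    have : LinearMap.range h = ⊤ := by
      rw [Submodule.eq_top_iff']
      intro x
      rw [← Submodule.Quotient.mk_eq_zero]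
      exact Subsingleton.elim _ _
    rw [this]
    exact (Submodule.topEquiv.restrictScalars K).finrank_eq
  have d2 : finrank K (LinearMap.range h) = finrank K (LinearMap.ker π) :=
    ((LinearEquiv.ofInjective h hi).restrictScalars K).finrank_eq.symm
  have d3 := LinearMap.finrank_range_add_finrank_ker (π.restrictScalars K)
  rw [LinearMap.range_eq_top.mpr (show Function.Surjective (π.restrictScalars K) from hπ), finrank_top] at d3
  have d4 : finrank K (LinearMap.ker (π.restrictScalars K)) = finrank K (LinearMap.ker π) := rfl
  apply finrank_zero_iff (R := K).mp
  omega

end Generic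
end TorsAux

namespace TorsAux
open Module Filter

set_option linter.unusedSectionVars false

section Theta
variable {K A : Type} [Field K] [Infinite K] [Ring A] [Algebra K A] [FiniteDimensional K A]
variable {M N : Type}
  [AddCommGroup M] [Module K M] [Module A M] [IsScalarTower K A M] [Module.Finite K M]
  [AddCommGroup N] [Module K N] [Module A N] [IsScalarTower K A N] [Module.Finite K N]

theorem exists_theta (K : Type) {A : Type} [Field K] [Infinite K] [Ring A] [Algebra K A]
    [FiniteDimensional K A] {M N : Type}
    [AddCommGroup M] [Module K M] [Module A M] [IsScalarTower K A M] [Module.Finite K M]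
    [AddCommGroup N] [Module K N] [Module A N] [IsScalarTower K A N] [Module.Finite K N]
    (H : Hered A) {ι : Type} [Fintype ι] (D : Dec A ι)
    (hMN : ∀ φ : M →ₗ[A] N, φ = 0)
    (TF : ∀ (Z : Type) [AddCommGroup Z] [Module A Z], Module.Finite A Z →
      (∀ φ : Z →ₗ[A] N, φ = 0) → (∀ φ : M →ₗ[A] Z, φ = 0) → Subsingleton Z) :
    ∃ θ : ι → ℤ, (∀ L : Submodule A M, L ≠ ⊤ → 0 < ∑ i, θ i * (hd K A (D.Q i) (M ⧸ L) : ℤ)) ∧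
      (∀ L : Submodule A N, L ≠ ⊥ → ∑ i, θ i * (hd K A (D.Q i) L : ℤ) < 0) := by
  classical
  have hp : ∀ j, Module.Projective A (D.Q j) := fun j => H A inferInstance inferInstance _
  let v : Submodule A M × Submodule A N → ι → ℤ := fun p i =>
    (hd K A (D.Q i) (M ⧸ p.1) : ℤ) - (hd K A (D.Q i) p.2 : ℤ)
  let S : Set (ι → ℤ) := v '' {p | p.1 ≠ ⊤ ∨ p.2 ≠ ⊥}
  have hS : S.Finite := by
    refine (Set.finite_Icc (fun i => -(hd K A (D.Q i) N : ℤ)) (fun i => (hd K A (D.Q i) M : ℤ))).subset ?_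
    rintro _ ⟨p, _, rfl⟩
    constructor
    · intro i
      have h1 := hd_le_of_inj (K := K) (P := D.Q i) p.2.subtype p.2.injective_subtype
      simp only [v]
      omega
    · intro i
      have h1 := hd_quot (K := K) (P := D.Q i) p.1
      simp only [v]
      omega
  have : Finite S := hS
  obtain ⟨n, ⟨eq⟩⟩ := Finite.exists_equiv_fin S
  have hch : ∀ k : Fin n, ∃ p : Submodule A M × Submodule A N, (p.1 ≠ ⊤ ∨ p.2 ≠ ⊥) ∧
      v p = (eq.symm k : ι → ℤ) := fun k => (eq.symm k).2
  choose p hp1 hp2 using hch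
  rcases gordan_int (fun k => v (p k)) with ⟨θ, hθ⟩ | ⟨a, ⟨k0, hk0⟩, ha⟩
  · have key : ∀ q : Submodule A M × Submodule A N, (q.1 ≠ ⊤ ∨ q.2 ≠ ⊥) → 0 < ∑ i, θ i * v q i := by
      intro q hq
      have h1 := hθ (eq ⟨v q, q, hq, rfl⟩)
      rw [hp2, Equiv.symm_apply_apply] at h1
      exact h1
    refine ⟨θ, ?_, ?_⟩
    · intro L hL
      have h1 := key (L, ⊥) (Or.inl hL)
      simpa [v, hd_zero] using h1
    · intro L hL
      have h1 := key (⊤, L) (Or.inr hL)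
      have : Subsingleton (M ⧸ (⊤ : Submodule A M)) := ⟨fun x y => by
        obtain ⟨x, rfl⟩ := Submodule.mkQ_surjective _ x
        obtain ⟨y, rfl⟩ := Submodule.mkQ_surjective _ y
        exact (Submodule.Quotient.eq _).mpr trivial⟩
      simpa [v, hd_zero] using h1
  · exfalso
    let X : Type := (x : Σ k : Fin n, Fin (a k)) → M ⧸ (p x.1).1
    let Y : Type := (x : Σ k : Fin n, Fin (a k)) → (p x.1).2
    have hX : ∀ i, hd K A (D.Q i) X = ∑ k, a k * hd K A (D.Q i) (M ⧸ (p k).1) := by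
      intro i
      rw [hd_pi_right, Fintype.sum_sigma]
      refine Finset.sum_congr rfl fun k _ => ?_
      show ∑ _y : Fin (a k), hd K A (D.Q i) (M ⧸ (p k).1) = _
      simp
    have hY : ∀ i, hd K A (D.Q i) Y = ∑ k, a k * hd K A (D.Q i) (p k).2 := by
      intro i
      rw [hd_pi_right, Fintype.sum_sigma]
      refine Finset.sum_congr rfl fun k _ => ?_
      show ∑ _y : Fin (a k), hd K A (D.Q i) (p k).2 = _
      simp
    have he : ∀ i, hd K A (D.Q i) X = hd K A (D.Q i) Y := by
      intro i
      have h1 := ha i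
      rw [hX, hY]
      zify
      rw [← sub_eq_zero, ← h1, ← Finset.sum_sub_distrib]
      refine Finset.sum_congr rfl fun k _ => ?_
      simp only [v]
      ring
    have sX : Subsingleton X := by
      refine numdisj (K := K) (M := M) (N := N) (X := X) (Y := Y) H D TF ?_ ?_ he
      · intro φ
        refine LinearMap.pi_ext fun x y => ?_
        obtain ⟨m, rfl⟩ := Submodule.mkQ_surjective _ y
        exact LinearMap.congr_fun (hMN (φ.comp ((LinearMap.single A
          (fun x : Σ k : Fin n, Fin (a k) => M ⧸ (p x.1).1) x).comp (Submodule.mkQ _)))) m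
      · intro φ
        refine LinearMap.ext fun m => ?_
        funext x
        have := LinearMap.congr_fun (hMN ((p x.1).2.subtype.comp ((LinearMap.proj x).comp φ))) m
        exact Subtype.ext this
    have sY : Subsingleton Y := by
      by_contra hcon
      rw [not_subsingleton_iff_nontrivial] at hcon
      obtain ⟨y, hy⟩ := exists_ne (0 : Y)
      obtain ⟨i, f, hf⟩ := D.F1 y hy
      have h1 : 0 < hd K A (D.Q i) Y := Module.finrank_pos_iff_exists_ne_zero.mpr ⟨f, hf⟩
      rw [← he, hd_zero] at h1
      omega
    let x0 : Σ k : Fin n, Fin (a k) := ⟨k0, ⟨0, by omega⟩⟩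
    rcases hp1 k0 with h | h
    · apply h
      rw [Submodule.eq_top_iff']
      intro m
      rw [← Submodule.Quotient.mk_eq_zero]
      have := congrFun (Subsingleton.elim (Pi.single x0 (Submodule.Quotient.mk m) : X) 0) x0
      simpa using this
    · apply h
      rw [Submodule.eq_bot_iff]
      intro m hm
      have := congrFun (Subsingleton.elim (Pi.single x0 ⟨m, hm⟩ : Y) 0) x0
      simpa using this

theorem exists_P (K : Type) {A : Type} [Field K] [Infinite K] [Ring A] [Algebra K A]
    [FiniteDimensional K A] {M N : Type}
    [AddCommGroup M] [Module K M] [Module A M] [IsScalarTower K A M] [Module.Finite K M]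
    [AddCommGroup N] [Module K N] [Module A N] [IsScalarTower K A N] [Module.Finite K N]
    (H : Hered A) (hMN : ∀ φ : M →ₗ[A] N, φ = 0)
    (TF : ∀ (Z : Type) [AddCommGroup Z] [Module A Z], Module.Finite A Z →
      (∀ φ : Z →ₗ[A] N, φ = 0) → (∀ φ : M →ₗ[A] Z, φ = 0) → Subsingleton Z) :
    ∃ (P0 P1 : Type) (_ : AddCommGroup P0) (_ : Module K P0) (_ : Module A P0)
      (_ : IsScalarTower K A P0) (_ : Module.Finite K P0) (_ : Module.Projective A P0)
      (_ : AddCommGroup P1) (_ : Module K P1) (_ : Module A P1)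
      (_ : IsScalarTower K A P1) (_ : Module.Finite K P1) (_ : Module.Projective A P1),
      (∀ L : Submodule A M, L ≠ ⊤ → hd K A P1 (M ⧸ L) < hd K A P0 (M ⧸ L)) ∧
      (∀ L : Submodule A N, L ≠ ⊥ → hd K A P0 L < hd K A P1 L) := by
  classical
  obtain ⟨ι, _, ⟨D⟩⟩ := exists_dec K A
  have hp : ∀ j, Module.Projective A (D.Q j) := fun j => H A inferInstance inferInstance _
  obtain ⟨θ, h1, h2⟩ := exists_theta K H D hMN TF
  have key : ∀ (X : Type) [AddCommGroup X] [Module K X] [Module A X] [IsScalarTower K A X]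
      [Module.Finite K X] (c : ι → ℕ), hd K A ((x : Σ i, Fin (c i)) → D.Q x.1) X =
        ∑ i, c i * hd K A (D.Q i) X := by
    intro X _ _ _ _ _ c
    rw [hd_pi_left, Fintype.sum_sigma]
    refine Finset.sum_congr rfl fun k _ => ?_
    show ∑ _y : Fin (c k), hd K A (D.Q k) X = _
    simp
  have key2 : ∀ (X : Type) [AddCommGroup X] [Module K X] [Module A X] [IsScalarTower K A X]
      [Module.Finite K X], (hd K A ((x : Σ i, Fin ((θ i).toNat)) → D.Q x.1) X : ℤ) -
        (hd K A ((x : Σ i, Fin ((- θ i).toNat)) → D.Q x.1) X : ℤ) = ∑ i, θ i * (hd K A (D.Q i) X : ℤ) := by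
    intro X _ _ _ _ _
    rw [key X (fun i => (θ i).toNat), key X (fun i => (-θ i).toNat)]
    push_cast
    rw [← Finset.sum_sub_distrib]
    refine Finset.sum_congr rfl fun i _ => ?_
    rw [← sub_mul]
    congr 1
    omega
  refine ⟨(x : Σ i, Fin ((θ i).toNat)) → D.Q x.1, (x : Σ i, Fin ((- θ i).toNat)) → D.Q x.1,
    inferInstance, inferInstance, inferInstance, inferInstance, inferInstance, ?_,
    inferInstance, inferInstance, inferInstance, inferInstance, inferInstance, ?_, ?_, ?_⟩
  · exact Module.Projective.of_equiv (DirectSum.linearEquivFunOnFintype A _ _)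
  · exact Module.Projective.of_equiv (DirectSum.linearEquivFunOnFintype A _ _)
  · intro L hL
    have := h1 L hL
    rw [← key2] at this
    omega
  · intro L hL
    have := h2 L hL
    rw [← key2] at this
    omega

end Theta
end TorsAux

namespace TorsAux
open Module Filter

set_option linter.unusedSectionVars false

section Trace
variable {K A : Type} [Field K] [Ring A] [Algebra K A] [FiniteDimensional K A]
variable {B C X : Type}
  [AddCommGroup B] [Module K B] [Module A B] [IsScalarTower K A B] [Module.Finite K B]
  [AddCommGroup C] [Module K C] [Module A C] [IsScalarTower K A C] [Module.Finite K C]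
  [AddCommGroup X] [Module K X] [Module A X] [IsScalarTower K A X] [Module.Finite K X]

variable (K A B C X) in
/-- composition as a bilinear map -/
def compB : (B →ₗ[A] C) →ₗ[K] (C →ₗ[A] X) →ₗ[K] (B →ₗ[A] X) :=
  LinearMap.mk₂ K (fun e φ => φ.comp e) (fun e e' φ => by ext; simp)
    (fun c e φ => by
      refine LinearMap.ext fun x => ?_
      exact (φ.restrictScalars K).map_smul c _)
    (fun e φ φ' => rfl) (fun c e φ => rfl)

@[simp] theorem compB_apply (e : B →ₗ[A] C) (φ : C →ₗ[A] X) : compB K A B C X e φ = φ.comp e := rfl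

/-- the submodule generated by the images of the maps in `W` -/
def tr (W : Submodule K (C →ₗ[A] X)) : Submodule A X := ⨆ φ : W, LinearMap.range φ.1

theorem le_tr (W : Submodule K (C →ₗ[A] X)) (φ : C →ₗ[A] X) (h : φ ∈ W) : LinearMap.range φ ≤ tr W :=
  le_iSup (fun φ : W => LinearMap.range φ.1) ⟨φ, h⟩

theorem tr_lift [Module.Projective A B] (W : Submodule K (C →ₗ[A] X)) (g : B →ₗ[A] X)
    (hg : LinearMap.range g ≤ tr W) : g ∈ EW (compB K A B C X) W := by
  let b := Module.finBasis K W
  set r := finrank K W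
  let Φ : (Fin r → C) →ₗ[A] X := LinearMap.lsum A (fun _ => C) ℕ (fun k => (b k).1)
  have hΦ : ∀ c, Φ c = ∑ k, (b k).1 (c k) := fun c => by simp [Φ]
  have h1 : tr W ≤ LinearMap.range Φ := by
    refine iSup_le ?_
    rintro φ _ ⟨c, rfl⟩
    refine ⟨fun k => b.repr φ k • c, ?_⟩
    rw [hΦ]
    conv_rhs => rw [← b.sum_repr φ]
    rw [Submodule.coe_sum, LinearMap.sum_apply]
    refine Finset.sum_congr rfl fun k _ => ?_
    exact ((b k).1.restrictScalars K).map_smul _ _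
  obtain ⟨G, hG⟩ := Module.projective_lifting_property Φ.rangeRestrict
    (g.codRestrict _ (fun x => (hg.trans h1) ⟨x, rfl⟩)) Φ.surjective_rangeRestrict
  have h2 : g = ∑ k, (b k).1.comp ((LinearMap.proj k).comp G) := by
    refine LinearMap.ext fun x => ?_
    have := congrArg Subtype.val (LinearMap.congr_fun hG x)
    rw [LinearMap.sum_apply]
    refine Eq.trans this.symm ?_
    exact hΦ _
  rw [h2]
  refine Submodule.sum_mem _ fun k _ => ?_
  exact Submodule.mem_iSup_of_mem ((LinearMap.proj k).comp G) ⟨(b k).1, (b k).2, rfl⟩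

theorem finrank_le_hd (L : Submodule A X) (W : Submodule K (C →ₗ[A] X))
    (h : ∀ φ ∈ W, LinearMap.range φ ≤ L) : finrank K W ≤ hd K A C L := by
  let j : W →ₗ[K] (C →ₗ[A] L) :=
    { toFun := fun φ => φ.1.codRestrict L (fun x => h φ.1 φ.2 ⟨x, rfl⟩)
      map_add' := fun _ _ => rfl
      map_smul' := fun _ _ => rfl }
  refine LinearMap.finrank_le_finrank_of_injective (f := j) ?_
  intro φ ψ he
  refine Subtype.ext (LinearMap.ext fun x => ?_)
  exact congrArg Subtype.val (LinearMap.congr_fun he x)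

theorem hd_le_finrank (L : Submodule A X) (W : Submodule K (C →ₗ[A] X))
    (h : ∀ φ : C →ₗ[A] X, LinearMap.range φ ≤ L → φ ∈ W) : hd K A C L ≤ finrank K W := by
  let j : (C →ₗ[A] L) →ₗ[K] W := (post K C L.subtype).codRestrict W (fun φ => h _ (by
    rintro _ ⟨x, rfl⟩
    exact (φ x).2))
  refine LinearMap.finrank_le_finrank_of_injective (f := j) ?_
  intro φ ψ he
  refine LinearMap.ext fun x => Subtype.ext ?_
  exact LinearMap.congr_fun (congrArg Subtype.val he) x

end Trace

section SM
variable {K A : Type} [Field K] [Infinite K] [Ring A] [Algebra K A] [FiniteDimensional K A]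
variable {M N B0 B1 : Type}
  [AddCommGroup M] [Module K M] [Module A M] [IsScalarTower K A M] [Module.Finite K M]
  [AddCommGroup N] [Module K N] [Module A N] [IsScalarTower K A N] [Module.Finite K N]
  [AddCommGroup B0] [Module K B0] [Module A B0] [IsScalarTower K A B0] [Module.Finite K B0]
  [AddCommGroup B1] [Module K B1] [Module A B1] [IsScalarTower K A B1] [Module.Finite K B1]

theorem blowM [Module.Projective A B0] [Module.Projective A B1]
    (hlt : ∀ L : Submodule A M, L ≠ ⊤ → hd K A B1 (M ⧸ L) < hd K A B0 (M ⧸ L)) (ε : ℝ) (hε : 0 < ε) :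
    ∃ (ι : Type) (_ : Fintype ι) (_ : Nonempty ι) (h : ι → ι → (B1 →ₗ[A] B0)),
        co (act (compB K A B1 B0 M) h) ≤ ε * Fintype.card ι := by
  have top : ∀ W : Submodule K (B0 →ₗ[A] M), tr W = ⊤ → EW (compB K A B1 B0 M) W = ⊤ := by
    intro W h
    rw [Submodule.eq_top_iff']
    intro g
    apply tr_lift
    rw [h]
    exact le_top
  refine blow _ _ _ (compB K A B1 B0 M) le_rfl ?_ ?_ ε hε
  · intro W hW
    by_cases h : tr W = ⊤
    · rw [top W h, finrank_top]
      have := Submodule.finrank_lt hW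
      omega
    · have h1 := hlt _ h
      have h2 := hd_quot (K := K) (P := B1) (tr W)
      have h3 := hd_quot (K := K) (P := B0) (tr W)
      have h4 := finrank_le_hd (tr W) W (le_tr W)
      have h5 := hd_le_finrank (tr W) (EW (compB K A B1 B0 M) W) (fun φ => tr_lift W φ)
      unfold hd at *
      omega
  · apply top
    by_contra h
    have h1 := hlt _ h
    have h3 := hd_quot (K := K) (P := B0) (tr (⊤ : Submodule K (B0 →ₗ[A] M)))
    have h4 := finrank_le_hd (tr (⊤ : Submodule K (B0 →ₗ[A] M))) ⊤ (le_tr ⊤)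
    rw [finrank_top] at h4
    unfold hd at *
    omega

theorem SM [Module.Projective A B0] [Module.Projective A B1]
    (hlt : ∀ L : Submodule A M, L ≠ ⊤ → hd K A B1 (M ⧸ L) < hd K A B0 (M ⧸ L)) :
    ∃ (ι : Type) (_ : Fintype ι) (_ : Nonempty ι) (h : (ι → B1) →ₗ[A] (ι → B0 × A)),
      ∀ φ : (ι → B1) →ₗ[A] M, ∃ ψ : (ι → B0 × A) →ₗ[A] M, ψ.comp h = φ := by
  classical
  have fM : Module.Finite A M := Module.Finite.of_restrictScalars_finite K A _
  obtain ⟨m, π, hπ⟩ := Module.Finite.exists_fin' A M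
  obtain ⟨ι, _, _, c, hc⟩ := blowM hlt (1 / (m + 1)) (by positivity)
  refine ⟨ι, inferInstance, inferInstance, ?_⟩
  let hh : (ι → B1) →ₗ[A] (ι → B0) := LinearMap.pi fun i => ∑ j, (c i j).comp (LinearMap.proj j)
  have hhh : ∀ x i, hh x i = ∑ j, c i j (x j) := fun x i => by simp [hh]
  let V := LinearMap.range (act (compB K A B1 B0 M) c)
  obtain ⟨V', hV'⟩ := V.exists_isCompl
  let w := Module.finBasis K V'
  set r := finrank K V' with hr
  have hrm : r * m ≤ Fintype.card ι := by
    have h1 := Submodule.finrank_add_eq_of_isCompl hV'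
    have h2 : (r : ℝ) = co (act (compB K A B1 B0 M) c) := by
      unfold co
      rw [← h1]
      push_cast
      ring
    rw [← h2] at hc
    have h3 : (r : ℝ) * (m + 1) ≤ Fintype.card ι := by
      rw [one_div, ← div_eq_inv_mul, le_div_iff₀ (by positivity)] at hc
      exact hc
    have h4 : r * (m + 1) ≤ Fintype.card ι := by exact_mod_cast h3
    nlinarith
  obtain ⟨em⟩ : Nonempty (Fin r × Fin m ↪ ι) := by
    apply Function.Embedding.nonempty_of_card_le
    simpa using hrm
  -- lift the basis vectors
  have hl : ∀ k : Fin r, ∀ j : ι, ∃ η : B1 →ₗ[A] (Fin m → A), π.comp η = (w k).1 j := fun k j =>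
    Module.projective_lifting_property π _ hπ
  choose η hη using hl
  let ηη : (ι → B1) →ₗ[A] (ι → A) := LinearMap.pi fun i =>
    if hi : ∃ p, em p = i then
      (LinearMap.proj hi.choose.2).comp (∑ j, (η hi.choose.1 j).comp (LinearMap.proj j)) else 0
  have hηη : ∀ x p, ηη x (em p) = ∑ j, η p.1 j (x j) p.2 := by
    intro x p
    have hi : ∃ q, em q = em p := ⟨p, rfl⟩
    have hq : hi.choose = p := em.injective hi.choose_spec
    simp only [ηη, LinearMap.pi_apply, dif_pos hi, LinearMap.comp_apply, LinearMap.proj_apply,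
      LinearMap.sum_apply, Finset.sum_apply]
    rw [hq]
  refine ⟨LinearMap.pi fun i => ((LinearMap.proj i).comp hh).prod ((LinearMap.proj i).comp ηη), ?_⟩
  intro φ
  let φ' : ι → B1 →ₗ[A] M := fun j => φ.comp (LinearMap.single A (fun _ => B1) j)
  have hφ' : ∀ x, φ x = ∑ j, φ' j (x j) := by
    intro x
    conv_lhs => rw [← Finset.univ_sum_single x]
    rw [map_sum]
    rfl
  have hmem : φ' ∈ V ⊔ V' := by rw [hV'.sup_eq_top]; trivial
  obtain ⟨_, ⟨α, rfl⟩, v', hv', hsum⟩ := Submodule.mem_sup.mp hmem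
  let t := w.repr ⟨v', hv'⟩
  have ht : v' = ∑ k, t k • (w k).1 := by
    have := congrArg Subtype.val (w.sum_repr ⟨v', hv'⟩)
    rw [Submodule.coe_sum] at this
    exact this.symm
  let ψ1 : (ι → B0 × A) →ₗ[A] M := ∑ i, (α i).comp ((LinearMap.fst A B0 A).comp (LinearMap.proj i))
  let ψ2 : (ι → B0 × A) →ₗ[A] M := ∑ k, t k •
    π.comp (LinearMap.pi fun l => (LinearMap.snd A B0 A).comp (LinearMap.proj (em (k, l))))
  refine ⟨ψ1 + ψ2, LinearMap.ext fun x => ?_⟩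
  rw [hφ']
  have e1 : ψ1 ((LinearMap.pi fun i => ((LinearMap.proj i).comp hh).prod ((LinearMap.proj i).comp ηη)) x)
      = ∑ j, act (compB K A B1 B0 M) c α j (x j) := by
    simp only [ψ1, LinearMap.sum_apply, LinearMap.comp_apply, act_apply, compB_apply]
    rw [Finset.sum_comm]
    refine Finset.sum_congr rfl fun i _ => ?_
    rw [← map_sum, ← hhh]
    rfl
  have e2 : ψ2 ((LinearMap.pi fun i => ((LinearMap.proj i).comp hh).prod ((LinearMap.proj i).comp ηη)) x)
      = ∑ j, v' j (x j) := by
    rw [ht]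
    simp only [ψ2, LinearMap.sum_apply, LinearMap.smul_apply, LinearMap.comp_apply, Finset.sum_apply,
      Pi.smul_apply]
    rw [Finset.sum_comm]
    refine Finset.sum_congr rfl fun k _ => ?_
    rw [← Finset.smul_sum]
    congr 1
    have : (LinearMap.pi fun l => (LinearMap.snd A B0 A).comp (LinearMap.proj (em (k, l))))
        ((LinearMap.pi fun i => ((LinearMap.proj i).comp hh).prod ((LinearMap.proj i).comp ηη)) x) =
        ∑ j, η k j (x j) := by
      funext l
      rw [Finset.sum_apply]
      exact hηη x (k, l)
    rw [this, map_sum]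
    refine Finset.sum_congr rfl fun j _ => ?_
    exact LinearMap.congr_fun (hη k j) (x j)
  simp only [LinearMap.comp_apply, LinearMap.add_apply]
  rw [e1, e2, ← Finset.sum_add_distrib]
  refine Finset.sum_congr rfl fun j _ => ?_
  rw [← hsum]
  rfl

end SM
end TorsAux

namespace TorsAux
open Module Filter

set_option linter.unusedSectionVars false

section SN
variable {K A : Type} [Field K] [Infinite K] [Ring A] [Algebra K A] [FiniteDimensional K A]
variable {N B1 C0 F : Type}
  [AddCommGroup N] [Module K N] [Module A N] [IsScalarTower K A N] [Module.Finite K N]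
  [AddCommGroup B1] [Module K B1] [Module A B1] [IsScalarTower K A B1] [Module.Finite K B1]
  [AddCommGroup C0] [Module K C0] [Module A C0] [IsScalarTower K A C0] [Module.Finite K C0]
  [AddCommGroup F] [Module K F] [Module A F] [IsScalarTower K A F] [Module.Finite K F]

theorem sep (c : ℕ) : ∀ (V : Submodule K (F →ₗ[A] N)), finrank K V ≤ c →
    ∃ y : Fin c → F, ∀ ψ ∈ V, (∀ k, ψ (y k) = 0) → ψ = 0 := by
  induction c with
  | zero =>
    intro V hV
    refine ⟨fun _ => 0, fun ψ hψ _ => ?_⟩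
    have : V = ⊥ := Submodule.finrank_eq_zero.mp (by omega)
    rw [this] at hψ
    exact hψ
  | succ c ih =>
    intro V hV
    by_cases h : V = ⊥
    · refine ⟨fun _ => 0, fun ψ hψ _ => ?_⟩
      rw [h] at hψ
      exact hψ
    · obtain ⟨ψ0, hψ0, hne⟩ := Submodule.exists_mem_ne_zero_of_ne_bot h
      obtain ⟨f, hf⟩ : ∃ f, ψ0 f ≠ 0 := by
        by_contra hcon
        push Not at hcon
        exact hne (LinearMap.ext hcon)
      let Z : Submodule K (F →ₗ[A] N) :=
        { carrier := {ψ | ψ f = 0}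
          add_mem' := fun {a b} ha hb => by
            simp only [Set.mem_ofPred_eq] at *
            rw [LinearMap.add_apply, ha, hb, add_zero]
          zero_mem' := rfl
          smul_mem' := fun t a ha => by
            simp only [Set.mem_ofPred_eq] at *
            rw [LinearMap.smul_apply, ha, smul_zero] }
      have hlt : V ⊓ Z < V := by
        refine lt_of_le_of_ne inf_le_left fun he => ?_
        have : ψ0 ∈ V ⊓ Z := by rw [he]; exact hψ0
        exact hf this.2
      have h2 := Submodule.finrank_lt_finrank_of_lt hlt
      obtain ⟨y, hy⟩ := ih (V ⊓ Z) (by omega)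
      refine ⟨Fin.cons f y, fun ψ hψ hk => hy ψ ⟨hψ, ?_⟩ fun k => ?_⟩
      · change ψ f = 0
        simpa using hk 0
      · simpa using hk k.succ

variable (K A B1 C0 N) in
/-- the dual composition -/
noncomputable def dcompB : (B1 →ₗ[A] C0) →ₗ[K] Dual K (B1 →ₗ[A] N) →ₗ[K] Dual K (C0 →ₗ[A] N) :=
  Module.Dual.transpose.comp (compB K A B1 C0 N)

theorem dcompB_apply (e : B1 →ₗ[A] C0) (w : Dual K (B1 →ₗ[A] N)) (φ : C0 →ₗ[A] N) :
    dcompB K A N B1 C0 e w φ = w (φ.comp e) := rfl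

theorem mem_coann (W : Submodule K (Dual K (B1 →ₗ[A] N))) (φ : C0 →ₗ[A] N) :
    φ ∈ (EW (dcompB K A N B1 C0) W).dualCoannihilator ↔ ∀ e : B1 →ₗ[A] C0, φ.comp e ∈ W.dualCoannihilator := by
  constructor
  · intro h e
    rw [Submodule.mem_dualCoannihilator] at h ⊢
    intro w hw
    exact h _ (mem_EW _ e hw)
  · intro h
    rw [EW, Submodule.dualCoannihilator_iSup_eq, Submodule.mem_iInf]
    intro e
    rw [Submodule.mem_dualCoannihilator]
    rintro _ ⟨w, hw, rfl⟩
    exact (Submodule.mem_dualCoannihilator _).mp (h e) w hw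

theorem coann_lt [Module.Projective A B1]
    (hlt : ∀ L : Submodule A N, L ≠ ⊥ → hd K A C0 L < hd K A B1 L)
    (W : Submodule K (Dual K (B1 →ₗ[A] N))) :
    (EW (dcompB K A N B1 C0) W).dualCoannihilator = ⊥ ∨
    finrank K (EW (dcompB K A N B1 C0) W).dualCoannihilator < finrank K W.dualCoannihilator := by
  set U0 := (EW (dcompB K A N B1 C0) W).dualCoannihilator with hU0
  by_cases h : tr U0 = ⊥
  · left
    rw [eq_bot_iff]
    intro φ hφ
    have := le_tr U0 φ hφ
    rw [h, le_bot_iff, LinearMap.range_eq_bot] at this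
    exact this
  · right
    have h1 := finrank_le_hd (tr U0) U0 (le_tr U0)
    have h2 := hlt _ h
    have h3 : hd K A B1 (tr U0) ≤ finrank K W.dualCoannihilator := by
      apply hd_le_finrank
      intro φ hφ
      have h4 := tr_lift (B := B1) U0 φ hφ
      have h5 : EW (compB K A B1 C0 N) U0 ≤ W.dualCoannihilator := by
        refine iSup_le fun e => ?_
        rintro _ ⟨ψ, hψ, rfl⟩
        exact (mem_coann W ψ).mp hψ e
      exact h5 h4
    omega

theorem blowN [Module.Projective A B1]
    (hlt : ∀ L : Submodule A N, L ≠ ⊥ → hd K A C0 L < hd K A B1 L) (ε : ℝ) (hε : 0 < ε) :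
    ∃ (ι : Type) (_ : Fintype ι) (_ : Nonempty ι) (h : ι → ι → (B1 →ₗ[A] C0)),
        co (act (dcompB K A N B1 C0) h) ≤ ε * Fintype.card ι := by
  refine blow _ _ _ (dcompB K A N B1 C0) le_rfl ?_ ?_ ε hε
  · intro W hW
    have h1 := Subspace.finrank_add_finrank_dualCoannihilator_eq W
    have h2 := Subspace.finrank_add_finrank_dualCoannihilator_eq (EW (dcompB K A N B1 C0) W)
    rw [Subspace.dual_finrank_eq, Subspace.dual_finrank_eq]
    have h3 := Submodule.finrank_lt hW
    rw [Subspace.dual_finrank_eq] at h3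
    rcases coann_lt hlt W with h | h
    · rw [h, finrank_bot] at h2
      omega
    · omega
  · have h2 := Subspace.finrank_add_finrank_dualCoannihilator_eq (EW (dcompB K A N B1 C0) ⊤)
    have h0 := Subspace.finrank_add_finrank_dualCoannihilator_eq (⊤ : Submodule K (Dual K (B1 →ₗ[A] N)))
    rw [finrank_top, Subspace.dual_finrank_eq] at h0
    apply Submodule.eq_top_of_finrank_eq
    rw [Subspace.dual_finrank_eq]
    rcases coann_lt hlt ⊤ with h | h
    · rw [h, finrank_bot] at h2
      omega
    · omega

theorem SN [Module.Projective A B1]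
    (hlt : ∀ L : Submodule A N, L ≠ ⊥ → hd K A C0 L < hd K A B1 L) :
    ∃ (ι : Type) (_ : Fintype ι) (_ : Nonempty ι) (h : (ι → B1 × A) →ₗ[A] (ι → C0)),
      ∀ φ : (ι → C0) →ₗ[A] N, φ.comp h = 0 → φ = 0 := by
  classical
  obtain ⟨ι, _, _, c, hc⟩ := blowN hlt 1 (by positivity)
  refine ⟨ι, inferInstance, inferInstance, ?_⟩
  let hh : (ι → B1) →ₗ[A] (ι → C0) := LinearMap.pi fun j => ∑ i, (c i j).comp (LinearMap.proj i)
  have hhh : ∀ x j, hh x j = ∑ i, c i j (x i) := fun x i => by simp [hh]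
  let comp : ι → ((ι → C0) →ₗ[A] N) → (C0 →ₗ[A] N) := fun j ψ => ψ.comp (LinearMap.single A (fun _ => C0) j)
  have hcomp : ∀ (ψ : (ι → C0) →ₗ[A] N) x, ψ x = ∑ j, comp j ψ (x j) := by
    intro ψ x
    conv_lhs => rw [← Finset.univ_sum_single x]
    rw [map_sum]
    rfl
  let V := LinearMap.ker (pre K N hh)
  let R := LinearMap.range (act (dcompB K A N B1 C0) c)
  let ev : ((ι → C0) →ₗ[A] N) →ₗ[K] Dual K (ι → Dual K (C0 →ₗ[A] N)) :=
    LinearMap.mk₂ K (fun ψ u => ∑ j, u j (comp j ψ))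
      (fun a b u => by
        rw [← Finset.sum_add_distrib]
        exact Finset.sum_congr rfl fun j _ => (u j).map_add (comp j a) (comp j b))
      (fun t a u => by
        rw [Finset.smul_sum]
        exact Finset.sum_congr rfl fun j _ => (u j).map_smul t (comp j a))
      (fun a u u' => by
        rw [← Finset.sum_add_distrib]
        rfl)
      (fun t a u => by
        rw [Finset.smul_sum]
        rfl)
  have hev : ∀ ψ u, ev ψ u = ∑ j, u j (comp j ψ) := fun _ _ => rfl
  have evinj : Function.Injective ev := by
    rw [← LinearMap.ker_eq_bot, LinearMap.ker_eq_bot']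
    intro ψ hψ
    refine LinearMap.ext fun x => ?_
    rw [hcomp]
    refine Finset.sum_eq_zero fun j _ => ?_
    have : comp j ψ = 0 := by
      rw [← Module.forall_dual_apply_eq_zero_iff K]
      intro w
      have h1 := hev ψ (Pi.single j w)
      rw [hψ, Finset.sum_eq_single j] at h1
      · simpa using h1.symm
      · intro i _ hi
        simp [hi]
      · simp
    rw [this]
    rfl
  have hVR : V.map ev ≤ R.dualAnnihilator := by
    rintro _ ⟨ψ, hψ, rfl⟩
    rw [Submodule.mem_dualAnnihilator]
    rintro _ ⟨w, rfl⟩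
    rw [hev]
    simp only [act_apply, LinearMap.sum_apply, dcompB_apply]
    rw [Finset.sum_comm]
    refine Finset.sum_eq_zero fun i _ => ?_
    rw [← map_sum]
    have : ∑ j, (comp j ψ).comp (c i j) = 0 := by
      refine LinearMap.ext fun b => ?_
      have h1 : ψ (hh (Pi.single i b)) = 0 := LinearMap.congr_fun hψ (Pi.single i b)
      rw [hcomp] at h1
      rw [LinearMap.sum_apply, LinearMap.zero_apply, ← h1]
      refine Finset.sum_congr rfl fun j _ => ?_
      rw [hhh, Finset.sum_eq_single i]
      · simp
      · intro k _ hk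
        simp [hk]
      · simp
    rw [this, map_zero]
  have hdim : finrank K V ≤ Fintype.card ι := by
    have h1 := Submodule.finrank_mono hVR
    rw [← (Submodule.equivMapOfInjective ev evinj V).finrank_eq] at h1
    have h2 := Subspace.finrank_add_finrank_dualAnnihilator_eq R
    unfold co at hc
    have h3 : (finrank K R : ℝ) + finrank K R.dualAnnihilator = finrank K (ι → Dual K (C0 →ₗ[A] N)) := by
      exact_mod_cast h2
    have h4 : (finrank K V : ℝ) ≤ finrank K R.dualAnnihilator := by exact_mod_cast h1
    have h5 : (finrank K V : ℝ) ≤ Fintype.card ι := by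
      change _ - (finrank K R : ℝ) ≤ _ at hc
      linarith
    exact_mod_cast h5
  obtain ⟨y, hy⟩ := sep _ V hdim
  let yy : (ι → A) →ₗ[A] (ι → C0) :=
    LinearMap.lsum A (fun _ => A) ℕ (fun i => LinearMap.toSpanSingleton A _ (y (Fintype.equivFin ι i)))
  have hyy : ∀ i, yy (Pi.single i 1) = y (Fintype.equivFin ι i) := by
    intro i
    simp [yy]
  let q1 : (ι → B1 × A) →ₗ[A] (ι → B1) := LinearMap.pi fun i => (LinearMap.fst A B1 A).comp (LinearMap.proj i)
  let q2 : (ι → B1 × A) →ₗ[A] (ι → A) := LinearMap.pi fun i => (LinearMap.snd A B1 A).comp (LinearMap.proj i)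
  refine ⟨hh.comp q1 + yy.comp q2, fun φ hφ => ?_⟩
  have key : ∀ (a : ι → B1) (b : ι → A), φ (hh a) + φ (yy b) = 0 := by
    intro a b
    have := LinearMap.congr_fun hφ (fun i => (a i, b i))
    rw [LinearMap.comp_apply, LinearMap.add_apply, map_add] at this
    exact this
  apply hy
  · refine LinearMap.ext fun a => ?_
    have := key a 0
    rw [map_zero, map_zero, add_zero] at this
    exact this
  · intro k
    have := key 0 (Pi.single ((Fintype.equivFin ι).symm k) 1)
    rw [map_zero, map_zero, zero_add, hyy, Equiv.apply_symm_apply] at this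
    exact this

end SN
end TorsAux

namespace TorsAux
open Module Filter

set_option linter.unusedSectionVars false

section Core

/-- apply a map componentwise -/
def pmap {A P Q : Type} [Ring A] [AddCommGroup P] [Module A P] [AddCommGroup Q] [Module A Q]
    (κ : Type) (h : P →ₗ[A] Q) : (κ → P) →ₗ[A] (κ → Q) :=
  LinearMap.pi fun k => h.comp (LinearMap.proj k)

theorem proj_pow {A P ι : Type} [Ring A] [AddCommGroup P] [Module A P] [Fintype ι]
    [Module.Projective A P] : Module.Projective A (ι → P) := by
  classical
  exact Module.Projective.of_equiv (DFinsupp.linearEquivFunOnFintype (R := A) (M := fun _ : ι => P))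

/-- swap of indices -/
def psw (A X ι κ : Type) [Ring A] [AddCommGroup X] [Module A X] : (ι → κ → X) →ₗ[A] (κ → ι → X) :=
  LinearMap.pi fun k => LinearMap.pi fun i =>
    (LinearMap.proj (φ := fun _ : κ => X) k).comp (LinearMap.proj (φ := fun _ : ι => κ → X) i)

theorem psw_surj (A X ι κ : Type) [Ring A] [AddCommGroup X] [Module A X] :
    Function.Surjective (psw A X ι κ) := fun x => ⟨fun i k => x k i, rfl⟩

theorem pmap_surj {A P Q M : Type} [Ring A] [AddCommGroup P] [Module A P] [AddCommGroup Q] [Module A Q]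
    [AddCommGroup M] [Module A M] (κ : Type) [Fintype κ] (h : P →ₗ[A] Q)
    (hs : ∀ φ : P →ₗ[A] M, ∃ ψ : Q →ₗ[A] M, ψ.comp h = φ) (φ : (κ → P) →ₗ[A] M) :
    ∃ ψ : (κ → Q) →ₗ[A] M, ψ.comp (pmap κ h) = φ := by
  classical
  choose ψ hψ using fun k => hs (φ.comp (LinearMap.single A (fun _ => P) k))
  refine ⟨∑ k, (ψ k).comp (LinearMap.proj k), LinearMap.ext fun x => ?_⟩
  conv_rhs => rw [← Finset.univ_sum_single x]
  rw [map_sum, LinearMap.comp_apply, LinearMap.sum_apply]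
  exact Finset.sum_congr rfl fun k _ => LinearMap.congr_fun (hψ k) (x k)

theorem pmap_inj {A P Q M : Type} [Ring A] [AddCommGroup P] [Module A P] [AddCommGroup Q] [Module A Q]
    [AddCommGroup M] [Module A M] (κ : Type) [Fintype κ] (h : P →ₗ[A] Q)
    (hs : ∀ φ : Q →ₗ[A] M, φ.comp h = 0 → φ = 0) (φ : (κ → Q) →ₗ[A] M) (hφ : φ.comp (pmap κ h) = 0) :
    φ = 0 := by
  classical
  refine LinearMap.pi_ext' fun k => ?_
  apply hs
  refine LinearMap.ext fun x => ?_
  have := LinearMap.congr_fun hφ (Pi.single k x)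
  rw [LinearMap.comp_apply] at this
  refine Eq.trans ?_ this
  change φ (Pi.single k (h x)) = φ _
  congr 1
  funext j
  change _ = h ((Pi.single k x : κ → P) j)
  rw [← Pi.apply_single (fun _ => h) (fun _ => map_zero h)]

variable {K A : Type} [Field K] [Infinite K] [Ring A] [Algebra K A] [FiniteDimensional K A]
variable {M N : Type}
  [AddCommGroup M] [Module K M] [Module A M] [IsScalarTower K A M] [Module.Finite K M]
  [AddCommGroup N] [Module K N] [Module A N] [IsScalarTower K A N] [Module.Finite K N]

theorem hd_pow {P X : Type} [AddCommGroup P] [Module K P] [Module A P] [IsScalarTower K A P]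
    [AddCommGroup X] [Module K X] [Module A X] [IsScalarTower K A X] [Module.Finite K P]
    [Module.Finite K X] (ι : Type) [Fintype ι] :
    hd K A (ι → P) X = Fintype.card ι * hd K A P X := by
  classical
  rw [hd_pi_left]
  simp

theorem core (H : Hered A) (hMN : ∀ φ : M →ₗ[A] N, φ = 0)
    (TF : ∀ (Z : Type) [AddCommGroup Z] [Module A Z], Module.Finite A Z → (∀ φ : Z →ₗ[A] N, φ = 0) →
      (∀ φ : M →ₗ[A] Z, φ = 0) → Subsingleton Z) :
    ∃ (Q1 Q0 : Type) (_ : AddCommGroup Q1) (_ : Module K Q1) (_ : Module A Q1) (_ : IsScalarTower K A Q1)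
      (_ : Module.Finite K Q1) (_ : Module.Projective A Q1)
      (_ : AddCommGroup Q0) (_ : Module K Q0) (_ : Module A Q0) (_ : IsScalarTower K A Q0)
      (_ : Module.Finite K Q0) (_ : Module.Projective A Q0) (h : Q1 →ₗ[A] Q0),
      (∀ φ : Q1 →ₗ[A] M, ∃ ψ : Q0 →ₗ[A] M, ψ.comp h = φ) ∧
      (∀ φ : Q0 →ₗ[A] N, φ.comp h = 0 → φ = 0) ∧
      (∀ L : Submodule A N, L ≠ ⊥ → hd K A Q0 L < hd K A Q1 L) := by
  classical
  obtain ⟨P0, P1, _, _, _, _, _, _, _, _, _, _, _, _, hM, hN⟩ := exists_P K H hMN TF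
  let s := finrank K M + finrank K N + 1
  have h1 : ∀ L : Submodule A M, L ≠ ⊤ →
      hd K A ((Fin s → P1) × A) (M ⧸ L) < hd K A (Fin s → P0) (M ⧸ L) := by
    intro L hL
    rw [hd_prod_left, hd_pow, hd_pow, hd_A, Fintype.card_fin]
    have h2 := hM L hL
    have h3 : finrank K (M ⧸ L) ≤ finrank K M :=
      LinearMap.finrank_le_finrank_of_surjective (f := L.mkQ.restrictScalars K) L.mkQ_surjective
    have h4 : s * (hd K A P1 (M ⧸ L) + 1) ≤ s * hd K A P0 (M ⧸ L) := Nat.mul_le_mul_left _ h2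
    have h5 : finrank K (M ⧸ L) < s := by omega
    rw [Nat.mul_add] at h4
    omega
  have h1' : ∀ L : Submodule A N, L ≠ ⊥ →
      hd K A ((Fin s → P0) × A) L < hd K A (Fin s → P1) L := by
    intro L hL
    rw [hd_prod_left, hd_pow, hd_pow, hd_A, Fintype.card_fin]
    have h2 := hN L hL
    have h3 : finrank K L ≤ finrank K N :=
      LinearMap.finrank_le_finrank_of_injective (f := L.subtype.restrictScalars K) L.injective_subtype
    have h4 : s * (hd K A P0 L + 1) ≤ s * hd K A P1 L := Nat.mul_le_mul_left _ h2
    have h5 : finrank K L < s := by omega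
    rw [Nat.mul_add] at h4
    omega
  have : Module.Projective A (Fin s → P0) := proj_pow
  have : Module.Projective A (Fin s → P1) := proj_pow
  obtain ⟨ιa, _, _, ha, hha⟩ := SM h1
  obtain ⟨ιb, _, _, hb, hhb⟩ := SN h1'
  let X := (Fin s → P1) × A
  let Y := (Fin s → P0) × A
  let fa : (ιb → ιa → X) →ₗ[A] (ιb → ιa → Y) := pmap ιb ha
  let fb : (ιb → ιa → X) →ₗ[A] (ιb → ιa → Y) := (psw A Y ιa ιb).comp ((pmap ιa hb).comp (psw A X ιb ιa))
  have hfa : ∀ φ : (ιb → ιa → X) →ₗ[A] M, ∃ ψ : (ιb → ιa → Y) →ₗ[A] M, ψ.comp fa = φ :=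
    pmap_surj ιb ha hha
  have hfb : ∀ φ : (ιb → ιa → Y) →ₗ[A] N, φ.comp fb = 0 → φ = 0 := by
    intro φ hφ
    have h2 : (φ.comp (psw A Y ιa ιb)).comp (pmap ιa hb) = 0 := by
      refine LinearMap.ext fun x => ?_
      obtain ⟨x, rfl⟩ := psw_surj A X ιb ιa x
      exact LinearMap.congr_fun hφ x
    have h3 := pmap_inj ιa hb hhb _ h2
    refine LinearMap.ext fun y => ?_
    obtain ⟨y, rfl⟩ := psw_surj A Y ιa ιb y
    exact LinearMap.congr_fun h3 y
  -- the line
  have e1 := gen_surj (pre K M fa) (pre K M (fb - fa)) 0 (by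
    rw [zero_smul, add_zero]
    intro φ
    obtain ⟨ψ, hψ⟩ := hfa φ
    exact ⟨ψ, hψ⟩)
  have e2 := gen_inj (pre K N fa) (pre K N (fb - fa)) 1 (by
    rw [← pre_line, one_smul, add_sub_cancel, ← LinearMap.ker_eq_bot, LinearMap.ker_eq_bot']
    exact hfb)
  obtain ⟨t, ht1, ht2⟩ := (e1.and e2).exists
  rw [← pre_line] at ht1 ht2
  have : Module.Projective A (ιa → X) := proj_pow
  have : Module.Projective A (ιa → Y) := proj_pow
  have : Module.Projective A (ιb → ιa → X) := proj_pow
  have : Module.Projective A (ιb → ιa → Y) := proj_pow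
  refine ⟨ιb → ιa → X, ιb → ιa → Y, inferInstance, inferInstance, inferInstance, inferInstance, inferInstance,
    inferInstance, inferInstance, inferInstance, inferInstance, inferInstance, inferInstance,
    inferInstance, fa + t • (fb - fa), fun φ => ht1 φ, fun φ hφ => ht2 ?_, ?_⟩
  · rw [map_zero]
    exact hφ
  · intro L hL
    rw [hd_pow, hd_pow, hd_pow, hd_pow]
    have h2 := h1' L hL
    have h3 : hd K A X L = hd K A (Fin s → P1) L + hd K A A L := hd_prod_left
    have h4 : hd K A Y L < hd K A X L := by
      change hd K A ((Fin s → P0) × A) L < _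
      omega
    exact Nat.mul_lt_mul_of_pos_left (Nat.mul_lt_mul_of_pos_left h4 Fintype.card_pos) Fintype.card_pos

end Core
end TorsAux

namespace TorsAux
open Module Filter

set_option linter.unusedSectionVars false

section Approx
variable {K A : Type} [Field K] [Ring A] [Algebra K A] [FiniteDimensional K A]
variable {N Q1 Q0 X : Type}
  [AddCommGroup N] [Module K N] [Module A N] [IsScalarTower K A N] [Module.Finite K N]
  [AddCommGroup Q1] [Module K Q1] [Module A Q1] [IsScalarTower K A Q1] [Module.Finite K Q1]
  [AddCommGroup Q0] [Module K Q0] [Module A Q0] [IsScalarTower K A Q0] [Module.Finite K Q0]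
  [AddCommGroup X] [Module K X] [Module A X] [IsScalarTower K A X] [Module.Finite K X]

theorem leftApprox [Module.Projective A Q1] [Module.Projective A Q0] (h : Q1 →ₗ[A] Q0)
    (hinj : ∀ φ : Q0 →ₗ[A] N, φ.comp h = 0 → φ = 0)
    (hlt : ∀ L : Submodule A N, L ≠ ⊥ → hd K A Q0 L < hd K A Q1 L)
    (hB : ∀ (B : Type) [AddCommGroup B] [Module A B], Module.Finite A B → (∀ φ : B →ₗ[A] N, φ = 0) →
      ∀ φ : Q1 →ₗ[A] B, ∃ ψ : Q0 →ₗ[A] B, ψ.comp h = φ) :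
    ∃ (E : Type) (_ : AddCommGroup E) (_ : Module A E) (f : X →ₗ[A] E), Module.Finite A E ∧
      (∀ φ : E →ₗ[A] N, φ = 0) ∧
      ∀ (Y : Type) [AddCommGroup Y] [Module A Y],
        (∀ φ : Q1 →ₗ[A] Y, ∃ ψ : Q0 →ₗ[A] Y, ψ.comp h = φ) →
        ∀ g : X →ₗ[A] Y, ∃ k : E →ₗ[A] Y, k.comp f = g := by
  classical
  let x := Module.finBasis K (Q1 →ₗ[A] X)
  set k := finrank K (Q1 →ₗ[A] X)
  let xs : (Fin k → Q1) →ₗ[A] X := ∑ i, (x i).comp (LinearMap.proj i)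
  have hxs : ∀ p, xs p = ∑ i, x i (p i) := fun p => by simp [xs]
  let ρ : (Fin k → Q1) →ₗ[A] (Fin k → Q0) × X := (pmap (Fin k) h).prod (-xs)
  have hρ : ∀ p, ρ p = (pmap (Fin k) h p, - xs p) := fun p => rfl
  have fK : Module.Finite K (((Fin k → Q0) × X) ⧸ LinearMap.range ρ) := quotFin _
  refine ⟨((Fin k → Q0) × X) ⧸ LinearMap.range ρ, inferInstance, inferInstance,
    (LinearMap.range ρ).mkQ.comp (LinearMap.inr A _ X), Module.Finite.of_restrictScalars_finite K A _, ?_, ?_⟩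
  · intro φ
    let Φ : ((Fin k → Q0) × X) →ₗ[A] N := φ.comp (LinearMap.range ρ).mkQ
    have hΦρ : ∀ p, Φ (ρ p) = 0 := by
      intro p
      have : (LinearMap.range ρ).mkQ (ρ p) = 0 := (Submodule.Quotient.mk_eq_zero _).mpr ⟨p, rfl⟩
      change φ ((LinearMap.range ρ).mkQ (ρ p)) = 0
      rw [this, map_zero]
    let N' := LinearMap.range Φ
    let Φ' : ((Fin k → Q0) × X) →ₗ[A] N' := Φ.rangeRestrict
    have hΦ's : Function.Surjective Φ' := Φ.surjective_rangeRestrict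
    have hΦ'ρ : ∀ p, Φ' (ρ p) = 0 := fun p => Subtype.ext (hΦρ p)
    let a : X →ₗ[A] N' := Φ'.comp (LinearMap.inr A _ X)
    have hax : ∀ p, Φ' (pmap (Fin k) h p, 0) = a (xs p) := by
      intro p
      have h1 := hΦ'ρ p
      have h2 : ρ p = (pmap (Fin k) h p, 0) - (0, xs p) := by
        rw [hρ]
        simp
      rw [h2, map_sub, sub_eq_zero] at h1
      exact h1
    have hN' : N' = ⊥ := by
      by_contra hne
      have h1 := hlt _ hne
      have h2 : Function.Surjective (pre K N' h) := by
        intro y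
        have hBN : ∀ θ : (N' ⧸ LinearMap.range a) →ₗ[A] N, θ = 0 := by
          intro θ
          have hθa : ∀ u, θ ((LinearMap.range a).mkQ (a u)) = 0 := by
            intro u
            have : (LinearMap.range a).mkQ (a u) = 0 := (Submodule.Quotient.mk_eq_zero _).mpr ⟨u, rfl⟩
            rw [this, map_zero]
          have h3 : ((θ.comp (LinearMap.range a).mkQ).comp Φ').comp (LinearMap.inl A (Fin k → Q0) X) = 0 := by
            apply pmap_inj (Fin k) h hinj
            refine LinearMap.ext fun p => ?_
            change θ ((LinearMap.range a).mkQ (Φ' (pmap (Fin k) h p, 0))) = 0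
            rw [hax, hθa]
          refine LinearMap.ext fun b => ?_
          obtain ⟨n, rfl⟩ := (LinearMap.range a).mkQ_surjective b
          obtain ⟨⟨q, u⟩, rfl⟩ := hΦ's n
          have h4 : Φ' (q, u) = Φ' (q, 0) + a u := by
            change _ = Φ' (q, 0) + Φ' (0, u)
            rw [← map_add]
            simp
          rw [h4, map_add, map_add, hθa, add_zero]
          exact LinearMap.congr_fun h3 q
        have fB : Module.Finite A (N' ⧸ LinearMap.range a) := Module.Finite.of_restrictScalars_finite K A _
        obtain ⟨z, hz⟩ := hB (N' ⧸ LinearMap.range a) fB hBN ((LinearMap.range a).mkQ.comp y)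
        obtain ⟨z', hz'⟩ := Module.projective_lifting_property (LinearMap.range a).mkQ z
          (LinearMap.range a).mkQ_surjective
        have hmem : ∀ p, (y - z'.comp h) p ∈ LinearMap.range a := by
          intro p
          rw [← Submodule.Quotient.mk_eq_zero]
          change (LinearMap.range a).mkQ (y p - z' (h p)) = 0
          rw [map_sub, sub_eq_zero]
          have e1 := LinearMap.congr_fun hz p
          have e2 := LinearMap.congr_fun hz' (h p)
          exact e1.symm.trans e2.symm
        obtain ⟨u, hu⟩ := Module.projective_lifting_property a.rangeRestrict
          ((y - z'.comp h).codRestrict _ hmem) a.surjective_rangeRestrict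
        have hu' : ∀ p, a (u p) = y p - z' (h p) := fun p => congrArg Subtype.val (LinearMap.congr_fun hu p)
        let b : Fin k → Q0 →ₗ[A] N' := fun i => Φ'.comp ((LinearMap.inl A (Fin k → Q0) X).comp
          (LinearMap.single A (fun _ => Q0) i))
        have hb : ∀ i p, b i (h p) = a (x i p) := by
          intro i p
          have h5 := hax (Pi.single i p)
          rw [hxs, Finset.sum_eq_single i] at h5
          · rw [Pi.single_eq_same] at h5
            rw [← h5]
            change Φ' (Pi.single i (h p), 0) = _
            congr 2
            funext j
            change _ = h ((Pi.single i p : Fin k → Q1) j)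
            rw [← Pi.apply_single (fun _ => h) (fun _ => map_zero h)]
          · intro j _ hj
            simp [hj]
          · simp
        refine ⟨z' + ∑ i, x.repr u i • b i, LinearMap.ext fun p => ?_⟩
        have h6 : a (u p) = ∑ i, x.repr u i • b i (h p) := by
          have h7 : u p = ∑ i, x.repr u i • x i p := by
            conv_lhs => rw [← x.sum_repr u]
            rw [LinearMap.sum_apply]
            rfl
          rw [h7, map_sum]
          refine Finset.sum_congr rfl fun i _ => ?_
          rw [hb]
          exact (a.restrictScalars K).map_smul _ _
        rw [pre_apply, LinearMap.comp_apply, LinearMap.add_apply, LinearMap.sum_apply]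
        simp only [LinearMap.smul_apply]
        rw [← h6, hu']
        abel
      have h3 := LinearMap.finrank_le_finrank_of_surjective h2
      unfold hd at h1
      omega
    have hΦ0 : Φ = 0 := LinearMap.range_eq_bot.mp hN'
    refine LinearMap.ext fun e => ?_
    obtain ⟨e, rfl⟩ := (LinearMap.range ρ).mkQ_surjective e
    exact LinearMap.congr_fun hΦ0 e
  · intro Y _ _ hY g
    choose ψ hψ using fun i => hY (g.comp (x i))
    let G : ((Fin k → Q0) × X) →ₗ[A] Y := (∑ i, (ψ i).comp (LinearMap.proj i)).coprod g
    have hG : LinearMap.range ρ ≤ LinearMap.ker G := by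
      rintro _ ⟨p, rfl⟩
      rw [LinearMap.mem_ker, hρ, LinearMap.coprod_apply, map_neg, hxs, map_sum, LinearMap.sum_apply,
        ← sub_eq_add_neg, sub_eq_zero]
      exact Finset.sum_congr rfl fun i _ => LinearMap.congr_fun (hψ i) (p i)
    refine ⟨(LinearMap.range ρ).liftQ G hG, LinearMap.ext fun u => ?_⟩
    change G (0, u) = g u
    rw [LinearMap.coprod_apply, map_zero, zero_add]

end Approx
end TorsAux

namespace TorsPaper

variable (A : Type) [Ring A]

section Final
variable {A}

theorem isTors_homZero (Y : Type) [AddCommGroup Y] [Module A Y] :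
    IsTorsionClass A (fun X => Module.Finite A X ∧ ∀ f : X →ₗ[A] Y, f = 0) where
  fin := fun _ h => h.1
  zero := fun X h => by
    refine ⟨?_, fun f => LinearMap.ext fun x => by rw [h x, map_zero]; rfl⟩
    have : Subsingleton X := ⟨fun a b => by rw [h a, h b]⟩
    infer_instance
  quot := fun X Z h fZ hq => by
    obtain ⟨q, hq⟩ := hq
    refine ⟨fZ, fun f => LinearMap.ext fun z => ?_⟩
    obtain ⟨x, rfl⟩ := hq z
    exact LinearMap.congr_fun (h.2 (f.comp q)) x
  ext := fun X fX L hL hQ => by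
    refine ⟨fX, fun f => ?_⟩
    have h1 : L ≤ LinearMap.ker f := fun x hx => LinearMap.congr_fun (hL.2 (f.comp L.subtype)) ⟨x, hx⟩
    have h2 := hQ.2 (L.liftQ f h1)
    refine LinearMap.ext fun x => ?_
    exact LinearMap.congr_fun h2 (L.mkQ x)

theorem isTorf_homZero (X : Type) [AddCommGroup X] [Module A X] :
    IsTorsionFreeClass A (fun Y => Module.Finite A Y ∧ ∀ f : X →ₗ[A] Y, f = 0) where
  fin := fun _ h => h.1
  zero := fun Y h => by
    refine ⟨?_, fun f => LinearMap.ext fun x => h _⟩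
    have : Subsingleton Y := ⟨fun a b => by rw [h a, h b]⟩
    infer_instance
  sub := fun Y Z h fZ hq => by
    obtain ⟨q, hq⟩ := hq
    refine ⟨fZ, fun f => LinearMap.ext fun z => hq ?_⟩
    have := LinearMap.congr_fun (h.2 (q.comp f)) z
    rw [LinearMap.zero_apply, map_zero]
    exact this
  ext := fun Y fY L hL hQ => by
    refine ⟨fY, fun f => ?_⟩
    have h2 := hQ.2 (L.mkQ.comp f)
    have h3 : ∀ x, f x ∈ L := fun x => (Submodule.Quotient.mk_eq_zero L).mp (LinearMap.congr_fun h2 x)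
    have h4 := hL.2 (f.codRestrict L h3)
    exact LinearMap.ext fun x => congrArg Subtype.val (LinearMap.congr_fun h4 x)

theorem isTors_surj {Q1 Q0 : Type} [AddCommGroup Q1] [Module A Q1] [AddCommGroup Q0] [Module A Q0]
    [Module.Projective A Q1] [Module.Projective A Q0] (h : Q1 →ₗ[A] Q0) :
    IsTorsionClass A (fun X => Module.Finite A X ∧ ∀ φ : Q1 →ₗ[A] X, ∃ ψ : Q0 →ₗ[A] X, ψ.comp h = φ) where
  fin := fun _ h => h.1
  zero := fun X hX => by
    refine ⟨?_, fun f => ⟨0, LinearMap.ext fun x => by rw [hX (f x)]; rfl⟩⟩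
    have : Subsingleton X := ⟨fun a b => by rw [hX a, hX b]⟩
    infer_instance
  quot := fun X Z hX fZ hq => by
    obtain ⟨q, hq⟩ := hq
    refine ⟨fZ, fun φ => ?_⟩
    obtain ⟨φ', hφ'⟩ := Module.projective_lifting_property q φ hq
    obtain ⟨ψ, hψ⟩ := hX.2 φ'
    refine ⟨q.comp ψ, ?_⟩
    rw [LinearMap.comp_assoc, hψ, hφ']
  ext := fun X fX L hL hQ => by
    refine ⟨fX, fun φ => ?_⟩
    obtain ⟨ψ, hψ⟩ := hQ.2 (L.mkQ.comp φ)
    obtain ⟨ψ', hψ'⟩ := Module.projective_lifting_property L.mkQ ψ L.mkQ_surjective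
    have h3 : ∀ x, (φ - ψ'.comp h) x ∈ L := fun x => by
      rw [← Submodule.Quotient.mk_eq_zero]
      change L.mkQ (φ x - ψ' (h x)) = 0
      rw [map_sub, sub_eq_zero]
      exact (LinearMap.congr_fun hψ x).symm.trans (LinearMap.congr_fun hψ' (h x)).symm
    obtain ⟨χ, hχ⟩ := hL.2 ((φ - ψ'.comp h).codRestrict L h3)
    refine ⟨ψ' + L.subtype.comp χ, LinearMap.ext fun x => ?_⟩
    have h4 : (χ (h x)).1 = φ x - ψ' (h x) := congrArg Subtype.val (LinearMap.congr_fun hχ x)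
    change ψ' (h x) + (χ (h x)).1 = φ x
    rw [h4]
    abel

theorem exists_torsion_sub [IsNoetherianRing A] (T : ModuleCat.{0} A → Prop) (hT : IsTorsionClass A T)
    (X : Type) [AddCommGroup X] [Module A X] [Module.Finite A X] :
    ∃ t : Submodule A X, T (ModuleCat.of A t) ∧
      ∀ Z : ModuleCat.{0} A, T Z → ∀ f : Z →ₗ[A] (X ⧸ t), f = 0 := by
  have nX : IsNoetherian A X := isNoetherian_of_isNoetherianRing_of_finite A X
  obtain ⟨t, ht, hmax⟩ := set_has_maximal_iff_noetherian.mpr nX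
    {t : Submodule A X | T (ModuleCat.of A t)} ⟨⊥, hT.zero _ (fun x => Subsingleton.elim (α := (⊥ : Submodule A X)) x 0)⟩
  refine ⟨t, ht, fun Z hZ f => ?_⟩
  let s := (LinearMap.range f).comap t.mkQ
  have hts : t ≤ s := fun x hx => by
    change t.mkQ x ∈ LinearMap.range f
    have : t.mkQ x = 0 := (Submodule.Quotient.mk_eq_zero _).mpr hx
    rw [this]
    exact zero_mem _
  let q : s →ₗ[A] LinearMap.range f := (t.mkQ.comp s.subtype).codRestrict _ (fun x => x.2)
  let t' : Submodule A s := t.comap s.subtype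
  have hsT : T (ModuleCat.of A s) := by
    refine hT.ext (ModuleCat.of A s) (inferInstanceAs (Module.Finite A s)) t' ?_ ?_
    · refine hT.quot _ _ ht (inferInstanceAs (Module.Finite A t')) ?_
      refine ⟨(t.subtype.codRestrict s (fun x => hts x.2)).codRestrict t' (fun x => x.2), ?_⟩
      rintro ⟨⟨x, hx⟩, hx'⟩
      exact ⟨⟨x, hx'⟩, rfl⟩
    · refine hT.quot _ _ hZ (inferInstanceAs (Module.Finite A (s ⧸ t'))) ?_
      -- a map from `s / t'` onto the range, bijective
      let r : (s ⧸ t') →ₗ[A] LinearMap.range f := t'.liftQ q (fun x hx => by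
        refine Subtype.ext ?_
        exact (Submodule.Quotient.mk_eq_zero _).mpr hx)
      have hr : Function.Bijective r := by
        constructor
        · rw [← LinearMap.ker_eq_bot, LinearMap.ker_eq_bot']
          intro y hy
          obtain ⟨x, rfl⟩ := t'.mkQ_surjective y
          refine (Submodule.Quotient.mk_eq_zero _).mpr ?_
          exact (Submodule.Quotient.mk_eq_zero t).mp (congrArg Subtype.val hy)
        · rintro ⟨y, hy⟩
          obtain ⟨x, rfl⟩ := t.mkQ_surjective y
          exact ⟨t'.mkQ ⟨x, hy⟩, rfl⟩
      let e := LinearEquiv.ofBijective r hr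
      exact ⟨e.symm.toLinearMap.comp f.rangeRestrict, e.symm.surjective.comp f.surjective_rangeRestrict⟩
  have hst : s = t := by
    by_contra hne
    exact hmax s hsT (lt_of_le_of_ne hts (Ne.symm hne))
  refine LinearMap.ext fun z => ?_
  obtain ⟨x, hx⟩ := t.mkQ_surjective (f z)
  have : x ∈ s := ⟨z, hx.symm⟩
  rw [hst] at this
  rw [← hx]
  exact (Submodule.Quotient.mk_eq_zero _).mpr this

end Final

/-- Over an algebraically closed field, every bicompact torsion class
over a finite dimensional hereditary algebra is functorially finite. -/
theorem stmt0 (K : Type) [Field K] [IsAlgClosed K]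
    [Algebra K A] [FiniteDimensional K A]
    (hered : ∀ M : ModuleCat.{0} A, Module.Finite A M → Module.Projective A M →
      ∀ N : Submodule A M, Module.Projective A N)
    (T : ModuleCat.{0} A → Prop) (hT : IsTorsionClass A T)
    (hbc : IsBicompactTors A T) :
    FunctoriallyFinite A T := by
  obtain ⟨⟨M, fM, hM⟩, ⟨N, fN, hN⟩⟩ := hbc
  have nA : IsNoetherianRing A := isNoetherian_of_tower K inferInstance
  have infK : Infinite K := IsAlgClosed.instInfinite
  have TM : T M := by
    rw [hM]
    intro T' _ h
    exact h M rfl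
  have FN : rightPerp A T N := by
    rw [hN]
    intro F' _ h
    exact h N rfl
  -- `T` is contained in every torsion class containing `M`
  have Tmin : ∀ T', IsTorsionClass A T' → T' M → ∀ X, T X → T' X := by
    intro T' hT' hMT' X hX
    rw [hM] at hX
    exact hX T' hT' (fun Y hY => by rw [hY]; exact hMT')
  have perpM : ∀ (Y : Type) [AddCommGroup Y] [Module A Y], (∀ f : M →ₗ[A] Y, f = 0) →
      ∀ X : ModuleCat.{0} A, T X → ∀ f : X →ₗ[A] Y, f = 0 := by
    intro Y _ _ hY X hX
    exact (Tmin _ (isTors_homZero Y) ⟨fM, hY⟩ X hX).2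
  have perpN : ∀ (X : Type) [AddCommGroup X] [Module A X], (∀ f : X →ₗ[A] N, f = 0) →
      ∀ Y : ModuleCat.{0} A, rightPerp A T Y → ∀ f : X →ₗ[A] Y, f = 0 := by
    intro X _ _ hX Y hY
    rw [hN] at hY
    exact (hY _ (isTorf_homZero X) (fun Z hZ => by rw [hZ]; exact ⟨fN, hX⟩)).2
  have memT : ∀ X : ModuleCat.{0} A, Module.Finite A X → (∀ f : X →ₗ[A] N, f = 0) → T X := by
    intro X fX hX
    obtain ⟨t, ht, htF⟩ := exists_torsion_sub T hT X
    have h1 := perpN X hX (ModuleCat.of A (X ⧸ t))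
      ⟨inferInstanceAs (Module.Finite A (X ⧸ t)), htF⟩ t.mkQ
    refine hT.quot _ X ht fX ⟨t.subtype, fun x => ?_⟩
    exact ⟨⟨x, (Submodule.Quotient.mk_eq_zero t).mp (LinearMap.congr_fun h1 x)⟩, rfl⟩
  refine ⟨fun X fX => ?_, fun X fX => ?_⟩
  · letI : Module K M := Module.compHom M (algebraMap K A)
    haveI : IsScalarTower K A M := IsScalarTower.of_algebraMap_smul fun _ _ => rfl
    letI : Module K N := Module.compHom N (algebraMap K A)
    haveI : IsScalarTower K A N := IsScalarTower.of_algebraMap_smul fun _ _ => rfl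
    letI : Module K X := Module.compHom X (algebraMap K A)
    haveI : IsScalarTower K A X := IsScalarTower.of_algebraMap_smul fun _ _ => rfl
    haveI : Module.Finite K M := Module.Finite.trans A M
    haveI : Module.Finite K N := Module.Finite.trans A N
    haveI : Module.Finite K X := Module.Finite.trans A X
    have H : TorsAux.Hered A := fun P _ _ h1 h2 L => hered (ModuleCat.of A P) h1 h2 L
    obtain ⟨Q1, Q0, _, _, _, _, _, _, _, _, _, _, _, _, h, hsM, hiN, hlt⟩ :=
      TorsAux.core (K := K) (A := A) (M := M) (N := N) H (FN.2 M TM) (by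
        intro Z _ _ fZ hZN hMZ
        have h1 := memT (ModuleCat.of A Z) fZ hZN
        have h2 := perpM Z hMZ (ModuleCat.of A Z) h1 LinearMap.id
        exact ⟨fun a b => (LinearMap.congr_fun h2 a).trans (LinearMap.congr_fun h2 b).symm⟩)
    have hB : ∀ X : ModuleCat.{0} A, T X → ∀ φ : Q1 →ₗ[A] X, ∃ ψ : Q0 →ₗ[A] X, ψ.comp h = φ :=
      fun X hX => (Tmin _ (isTors_surj h) ⟨fM, hsM⟩ X hX).2
    obtain ⟨E, _, _, f, fE, hEN, hap⟩ := TorsAux.leftApprox (K := K) (N := N) (X := X) h hiN hlt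
      (fun B _ _ fB hBN => hB (ModuleCat.of A B) (memT (ModuleCat.of A B) fB hBN))
    exact ⟨ModuleCat.of A E, f, memT (ModuleCat.of A E) fE hEN, fun Y hY g => hap Y (hB Y hY) g⟩
  · obtain ⟨t, ht, htF⟩ := exists_torsion_sub T hT X
    refine ⟨ModuleCat.of A t, t.subtype, ht, fun Y hY g => ?_⟩
    have h1 := htF Y hY (t.mkQ.comp g)
    exact ⟨g.codRestrict t (fun y => (Submodule.Quotient.mk_eq_zero t).mp (LinearMap.congr_fun h1 y)), rfl⟩
end TorsPaper
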